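/- Let N ≥ 3, α > 0, k = k(α) = (2N-2+α)/(2+α), and let F : ℝ → ℝ be continuously differentiable. Suppose V_α ∈ C²((0,∞)) is a positive solution of -V'' - (k/t)V' = F(V) on (0,∞) with lim_{t→0⁺} V_α'(t) = 0 and lim_{t→∞} V_α(t) = 0, that V_α has Morse index one, that V_α' ∈ E, that V_α is degenerate (the linearized ODE -ψ'' - (k/t)ψ' = F'(V_α)·ψ has a nontrivial solution ψ ∈ E), and that α is NOT an even integer. Let u_α(x) = V_α((2/(2+α))|x|^{(2+α)/2}). Then every solution w of the linearized problem -Δw = |x|^α F'(u_α)·w on ℝ^N∖{0} with |x|^{α/2}w ∈ L²(ℝ^N) and |∇w| ∈ L²(ℝ^N) is radial, of the form w(x) = ψ((2/(2+α))|x|^{(2+α)/2}) for some ψ ∈ E solving the linearized ODE, and the real vector space of all such solutions w has dimension n_α, the dimension of the space of E-solutions of the linearized ODE. -/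

import Mathlib

open MeasureTheory Filter Set Topology

/-- The Euclidean Laplacian: sum of second partial derivatives. -/
noncomputable def lap {N : ℕ} (u : EuclideanSpace ℝ (Fin N) → ℝ)
    (x : EuclideanSpace ℝ (Fin N)) : ℝ :=
  ∑ i : Fin N, fderiv ℝ (fun y => fderiv ℝ u y (EuclideanSpace.single i 1)) x
    (EuclideanSpace.single i 1)

/-- k(α) = (2N-2+α)/(2+α). -/
noncomputable def kk (N : ℕ) (α : ℝ) : ℝ := (2 * (N : ℝ) - 2 + α) / (2 + α)

/-- Membership in the space `E`: a `C¹` function on `(0,∞)` with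
`∫₀^∞ t^k ((w')² + w²) dt < ∞`. -/
def memE (k : ℝ) (w : ℝ → ℝ) : Prop :=
  ContDiffOn ℝ 1 w (Ioi 0) ∧
  IntegrableOn (fun t => t ^ k * ((deriv w t) ^ 2 + (w t) ^ 2)) (Ioi 0)

/-- The Rayleigh quotient
`R(w) = (∫₀^∞ t^k ((w')² − A·w²) dt) / (∫₀^∞ t^k w² dt)`. -/
noncomputable def Ray (k : ℝ) (A : ℝ → ℝ) (w : ℝ → ℝ) : ℝ :=
  (∫ t in Ioi (0:ℝ), t ^ k * ((deriv w t) ^ 2 - A t * (w t) ^ 2)) /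
    ∫ t in Ioi (0:ℝ), t ^ k * (w t) ^ 2

/-- Morse index one: the infimum of the Rayleigh quotient over nonzero elements of `E`
is negative, while on every two-dimensional subspace of `E` the maximum of the
Rayleigh quotient over nonzero elements is nonnegative. -/
def MorseIndexOne (k : ℝ) (A : ℝ → ℝ) : Prop :=
  (∃ w, memE k w ∧ (∃ t ∈ Ioi (0:ℝ), w t ≠ 0) ∧ Ray k A w < 0) ∧
  ∀ w₁ w₂ : ℝ → ℝ, memE k w₁ → memE k w₂ →
    (∀ c₁ c₂ : ℝ, (∀ t ∈ Ioi (0:ℝ), c₁ * w₁ t + c₂ * w₂ t = 0) → c₁ = 0 ∧ c₂ = 0) →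
    ∃ c₁ c₂ : ℝ, ¬(c₁ = 0 ∧ c₂ = 0) ∧
      0 ≤ Ray k A (fun t => c₁ * w₁ t + c₂ * w₂ t)

/-- Nondegeneracy: the linearized ODE `-w'' - (k/t) w' = A w` has no nontrivial
solution in `E`. -/
def RadNondeg (k : ℝ) (A : ℝ → ℝ) : Prop :=
  ∀ w : ℝ → ℝ, ContDiffOn ℝ 2 w (Ioi 0) → memE k w →
    (∀ t > (0:ℝ), -(deriv (deriv w) t) - k / t * deriv w t = A t * w t) →
    ∀ t > (0:ℝ), w t = 0

/-- A solution in `E` of the linearized ODE `-ψ'' - (k/t) ψ' = A ψ` on `(0,∞)`. -/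
def LinODESol (k : ℝ) (A : ℝ → ℝ) (ψ : ℝ → ℝ) : Prop :=
  ContDiffOn ℝ 2 ψ (Ioi 0) ∧ memE k ψ ∧
  ∀ t > (0:ℝ), -(deriv (deriv ψ) t) - k / t * deriv ψ t = A t * ψ t

/-- A solution of the linearized problem `-Δw = |x|^α a w` on `ℝ^N∖{0}` with
`|x|^{α/2} w ∈ L²(ℝ^N)` and `|∇w| ∈ L²(ℝ^N)`. -/
def LinSolution (N : ℕ) (α : ℝ) (a : EuclideanSpace ℝ (Fin N) → ℝ)
    (w : EuclideanSpace ℝ (Fin N) → ℝ) : Prop :=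
  ContDiffOn ℝ 2 w {x | x ≠ 0} ∧
  (∀ x : EuclideanSpace ℝ (Fin N), x ≠ 0 → -(lap w x) = ‖x‖ ^ α * a x * w x) ∧
  Integrable (fun x : EuclideanSpace ℝ (Fin N) => ‖x‖ ^ α * (w x) ^ 2) ∧
  Integrable (fun x : EuclideanSpace ℝ (Fin N) => ‖fderiv ℝ w x‖ ^ 2)

/-- `(N+2i)·(N+i-2)! / ((N-2)!·(i+1)!)`. -/
def dimN (N i : ℕ) : ℕ :=
  (N + 2 * i) * Nat.factorial (N + i - 2) / (Nat.factorial (N - 2) * Nat.factorial (i + 1))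

theorem integrableOn_Ioi_of_abs_le {f g : ℝ → ℝ} (hf : ContinuousOn f (Ioi 0))
    (hg : IntegrableOn g (Ioi 0)) (h : ∀ t > (0 : ℝ), |f t| ≤ g t) :
    IntegrableOn f (Ioi 0) :=
  Integrable.mono' hg (hf.aestronglyMeasurable measurableSet_Ioi)
    ((ae_restrict_iff' measurableSet_Ioi).2 (Eventually.of_forall h))

/-- If `g' = G` on `(0, ∞)` with `G` and `g / t` integrable, then `∫ G = 0`. -/
theorem setIntegral_Ioi_eq_zero_of_hasDerivAt {g G : ℝ → ℝ}
    (hd : ∀ t > (0 : ℝ), HasDerivAt g (G t) t) (hG : IntegrableOn G (Ioi 0))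
    (hg : IntegrableOn (fun t => t⁻¹ * g t) (Ioi 0)) : ∫ t in Ioi (0 : ℝ), G t = 0 := by
  have himg : Real.exp '' univ = Ioi 0 := by rw [image_univ, Real.range_exp]
  have hder : ∀ x ∈ (univ : Set ℝ), HasDerivWithinAt Real.exp (Real.exp x) univ x :=
    fun x _ => (Real.hasDerivAt_exp x).hasDerivWithinAt
  have hinj : InjOn Real.exp univ := Real.exp_injective.injOn
  rw [← himg] at hG hg ⊢
  rw [integrableOn_image_iff_integrableOn_abs_deriv_smul MeasurableSet.univ hder hinj,
    integrableOn_univ] at hG hg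
  rw [integral_image_eq_integral_abs_deriv_smul MeasurableSet.univ hder hinj, setIntegral_univ]
  refine integral_eq_zero_of_hasDerivAt_of_integrable (f := fun x => g (Real.exp x)) ?_ hG ?_
  · intro x
    have := (hd _ (Real.exp_pos x)).comp x (Real.hasDerivAt_exp x)
    simpa [abs_of_pos (Real.exp_pos x), mul_comm, Function.comp_def] using this
  · refine hg.congr (Eventually.of_forall fun x => ?_)
    have := (Real.exp_pos x).ne'
    simp [abs_of_pos (Real.exp_pos x)]

theorem memE.continuousOn {k : ℝ} {w : ℝ → ℝ} (h : memE k w) : ContinuousOn w (Ioi 0) :=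
  h.1.continuousOn

theorem memE.continuousOn_deriv {k : ℝ} {w : ℝ → ℝ} (h : memE k w) :
    ContinuousOn (deriv w) (Ioi 0) :=
  h.1.continuousOn_deriv_of_isOpen isOpen_Ioi le_rfl

theorem memE.hasDerivAt {k : ℝ} {w : ℝ → ℝ} (h : memE k w) {t : ℝ} (ht : 0 < t) :
    HasDerivAt w (deriv w t) t :=
  ((h.1.differentiableOn one_ne_zero).differentiableAt (Ioi_mem_nhds ht)).hasDerivAt

theorem continuousOn_rpow_Ioi (p : ℝ) : ContinuousOn (fun t : ℝ => t ^ p) (Ioi 0) :=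
  fun t ht => (Real.continuousAt_rpow_const t p (Or.inl (ne_of_gt ht))).continuousWithinAt

theorem memE.integrableOn_deriv_sq {k : ℝ} {w : ℝ → ℝ} (h : memE k w) :
    IntegrableOn (fun t => t ^ k * deriv w t ^ 2) (Ioi 0) := by
  refine integrableOn_Ioi_of_abs_le ((continuousOn_rpow_Ioi k).mul (h.continuousOn_deriv.pow 2))
    h.2 fun t ht => ?_
  have := Real.rpow_nonneg (le_of_lt ht) k
  rw [abs_of_nonneg (by positivity)]
  gcongr
  nlinarith [sq_nonneg (w t)]

theorem memE.integrableOn_sq {k : ℝ} {w : ℝ → ℝ} (h : memE k w) :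
    IntegrableOn (fun t => t ^ k * w t ^ 2) (Ioi 0) := by
  refine integrableOn_Ioi_of_abs_le ((continuousOn_rpow_Ioi k).mul (h.continuousOn.pow 2))
    h.2 fun t ht => ?_
  have := Real.rpow_nonneg (le_of_lt ht) k
  rw [abs_of_nonneg (by positivity)]
  gcongr
  nlinarith [sq_nonneg (deriv w t)]

/-- Hardy's inequality in qualitative form. -/
theorem memE.integrableOn_hardy {k : ℝ} (hk : 1 < k) {w : ℝ → ℝ} (h : memE k w) :
    IntegrableOn (fun t => t ^ (k - 2) * w t ^ 2) (Ioi 0) := by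
  have hcont : ContinuousOn (fun t => t ^ (k - 2) * w t ^ 2) (Ioi 0) :=
    (continuousOn_rpow_Ioi _).mul (h.continuousOn.pow 2)
  rw [← Ioc_union_Ioi_eq_Ioi zero_le_one]
  refine IntegrableOn.union ?_ ?_
  · have hsub : ∀ n : ℕ, Icc (1 / ((n : ℝ) + 1)) 1 ⊆ Ioi 0 := fun n t ht =>
      lt_of_lt_of_le (by positivity) ht.1
    have hle : ∀ n : ℕ, 1 / ((n : ℝ) + 1) ≤ 1 := fun n => by
      rw [div_le_one (by positivity)]; linarith [n.cast_nonneg (α := ℝ)]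
    refine integrableOn_Ioc_of_intervalIntegral_norm_bounded_left
      (I := 2 / (k - 1) * (w 1 ^ 2 + 2 / (k - 1) * ∫ t in Ioi (0 : ℝ), t ^ k * deriv w t ^ 2))
      (a := fun n : ℕ => 1 / ((n : ℝ) + 1)) (l := atTop) (fun n => ?_)
      tendsto_one_div_add_atTop_nhds_zero_nat (Eventually.of_forall fun n => ?_)
    · exact ((hcont.mono (hsub n)).integrableOn_Icc).mono_set Ioc_subset_Icc_self
    · set ε : ℝ := 1 / ((n : ℝ) + 1) with hε
      have hεp : 0 < ε := by positivity
      have hu : uIcc ε 1 = Icc ε 1 := uIcc_of_le (hle n)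
      have hcI : ∀ {f : ℝ → ℝ}, ContinuousOn f (Ioi 0) → IntervalIntegrable f volume ε 1 :=
        fun hf => ContinuousOn.intervalIntegrable (by rw [hu]; exact hf.mono (hsub n))
      have hder : ∀ t ∈ uIcc ε 1, HasDerivAt (fun t => t ^ (k - 1) * w t ^ 2)
          ((k - 1) * t ^ (k - 2) * w t ^ 2 + t ^ (k - 1) * (2 * w t * deriv w t)) t := by
        intro t ht
        rw [hu] at ht
        have ht0 : 0 < t := hsub n ht
        have h1 := (Real.hasDerivAt_rpow_const (x := t) (p := k - 1) (Or.inl ht0.ne')).mul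
          ((h.hasDerivAt ht0).pow 2)
        convert! h1 using 1
        rw [show k - 1 - 1 = k - 2 by ring]
        simp
      have hc1 : ContinuousOn (fun t => (k - 1) * t ^ (k - 2) * w t ^ 2 +
          t ^ (k - 1) * (2 * w t * deriv w t)) (Ioi 0) :=
        (((continuousOn_const.mul (continuousOn_rpow_Ioi _)).mul (h.continuousOn.pow 2))).add
          ((continuousOn_rpow_Ioi _).mul
            ((continuousOn_const.mul h.continuousOn).mul h.continuousOn_deriv))
      have hc2 : ContinuousOn (fun t => t ^ k * deriv w t ^ 2) (Ioi 0) :=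
        (continuousOn_rpow_Ioi _).mul (h.continuousOn_deriv.pow 2)
      have hftc := intervalIntegral.integral_eq_sub_of_hasDerivAt hder (hcI hc1)
      have hmono : ∫ t in ε..1, t ^ (k - 2) * w t ^ 2 ≤ ∫ t in ε..1, 2 / (k - 1) *
          (((k - 1) * t ^ (k - 2) * w t ^ 2 + t ^ (k - 1) * (2 * w t * deriv w t)) +
            2 / (k - 1) * (t ^ k * deriv w t ^ 2)) := by
        refine intervalIntegral.integral_mono_on (hle n) (hcI hcont)
          (hcI (continuousOn_const.mul (hc1.add (continuousOn_const.mul hc2)))) fun t ht => ?_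
        have ht0 : 0 < t := hsub n ht
        have e1 : t ^ (k - 1) = t ^ (k - 2) * t := by
          rw [← Real.rpow_add_one ht0.ne']; congr 1; ring
        have e2 : t ^ k = t ^ (k - 2) * t ^ 2 := by
          rw [← Real.rpow_natCast t 2, ← Real.rpow_add ht0]; congr 1; norm_num
        have hp : 0 ≤ t ^ (k - 2) := Real.rpow_nonneg ht0.le _
        have hk' : 0 < k - 1 := by linarith
        rw [e1, e2, ← sub_nonneg]
        have : 2 / (k - 1) * (((k - 1) * t ^ (k - 2) * w t ^ 2 +
            t ^ (k - 2) * t * (2 * w t * deriv w t)) +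
            2 / (k - 1) * (t ^ (k - 2) * t ^ 2 * deriv w t ^ 2)) - t ^ (k - 2) * w t ^ 2 =
            t ^ (k - 2) * (w t + 2 / (k - 1) * (t * deriv w t)) ^ 2 := by
          field_simp; ring
        rw [this]; positivity
      rw [← intervalIntegral.integral_of_le (hle n)]
      have hnorm : ∫ t in ε..1, ‖t ^ (k - 2) * w t ^ 2‖ = ∫ t in ε..1, t ^ (k - 2) * w t ^ 2 := by
        refine intervalIntegral.integral_congr fun t ht => ?_
        rw [hu] at ht
        have := Real.rpow_nonneg (le_of_lt (hsub n ht)) (k - 2)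
        exact Real.norm_of_nonneg (by positivity)
      rw [hnorm]
      refine hmono.trans ?_
      rw [intervalIntegral.integral_const_mul, intervalIntegral.integral_add (hcI hc1)
        ((hcI hc2).const_mul _), hftc, intervalIntegral.integral_const_mul]
      have hk' : 0 < k - 1 := by linarith
      have h3 : ∫ t in ε..1, t ^ k * deriv w t ^ 2 ≤
          ∫ t in Ioi (0 : ℝ), t ^ k * deriv w t ^ 2 := by
        rw [intervalIntegral.integral_of_le (hle n)]
        refine setIntegral_mono_set h.integrableOn_deriv_sq ?_ ?_
        · refine (ae_restrict_iff' measurableSet_Ioi).2 (Eventually.of_forall fun t ht => ?_)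
          have := Real.rpow_nonneg (le_of_lt ht) k
          simp only [Pi.zero_apply]; positivity
        · exact (Ioc_subset_Icc_self.trans (hsub n)).eventuallyLE
      have h4 : 0 ≤ ε ^ (k - 1) * w ε ^ 2 := by
        have := Real.rpow_nonneg hεp.le (k - 1); positivity
      rw [Real.one_rpow, one_mul]
      gcongr
      linarith
  · have hs : Ioi (1 : ℝ) ⊆ Ioi 0 := Ioi_subset_Ioi zero_le_one
    refine Integrable.mono' (h.integrableOn_sq.mono_set hs)
      ((hcont.mono hs).aestronglyMeasurable measurableSet_Ioi)
      ((ae_restrict_iff' measurableSet_Ioi).2 (Eventually.of_forall fun t (ht : 1 < t) => ?_))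
    have := Real.rpow_nonneg (zero_le_one.trans ht.le) (k - 2)
    rw [Real.norm_of_nonneg (by positivity)]
    gcongr
    · exact ht.le
    · linarith

theorem integrableOn_rpow_mul_mul {p : ℝ} {f g : ℝ → ℝ} (hf : ContinuousOn f (Ioi 0))
    (hg : ContinuousOn g (Ioi 0)) (hf2 : IntegrableOn (fun t => t ^ p * f t ^ 2) (Ioi 0))
    (hg2 : IntegrableOn (fun t => t ^ p * g t ^ 2) (Ioi 0)) :
    IntegrableOn (fun t => t ^ p * (f t * g t)) (Ioi 0) := by
  refine integrableOn_Ioi_of_abs_le ((continuousOn_rpow_Ioi p).mul (hf.mul hg)) (hf2.add hg2)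
    fun t ht => ?_
  have := Real.rpow_nonneg (le_of_lt ht) p
  rw [abs_mul, abs_of_nonneg this, Pi.add_apply, ← mul_add]
  gcongr
  rw [abs_le]
  constructor <;> nlinarith [sq_nonneg (f t + g t), sq_nonneg (f t - g t)]

/-- Weak form of `w'' + (k/t) w' + A w = r / t²` tested against `χ ∈ E`. -/
theorem integral_weak_form {k M : ℝ} (hk : 1 < k) {A w w'' r χ : ℝ → ℝ}
    (hA : ContinuousOn A (Ioi 0)) (hM : ∀ t > (0 : ℝ), |A t| ≤ M) (hw : memE k w)
    (hw' : ∀ t > (0 : ℝ), HasDerivAt (deriv w) (w'' t) t) (hr : ContinuousOn r (Ioi 0))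
    (hrI : IntegrableOn (fun t => t ^ (k - 2) * r t ^ 2) (Ioi 0))
    (heq : ∀ t > (0 : ℝ), w'' t + k / t * deriv w t + A t * w t = r t / t ^ 2)
    (hχ : memE k χ) :
    ∫ t in Ioi (0 : ℝ), t ^ k * (deriv w t * deriv χ t - A t * (w t * χ t)) =
      -∫ t in Ioi (0 : ℝ), t ^ (k - 2) * (r t * χ t) := by
  have h1 : IntegrableOn (fun t => t ^ k * (deriv w t * deriv χ t)) (Ioi 0) :=
    integrableOn_rpow_mul_mul hw.continuousOn_deriv hχ.continuousOn_deriv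
      hw.integrableOn_deriv_sq hχ.integrableOn_deriv_sq
  have h2 : IntegrableOn (fun t => t ^ k * (w t * χ t)) (Ioi 0) :=
    integrableOn_rpow_mul_mul hw.continuousOn hχ.continuousOn hw.integrableOn_sq hχ.integrableOn_sq
  have h3 : IntegrableOn (fun t => t ^ (k - 2) * (r t * χ t)) (Ioi 0) :=
    integrableOn_rpow_mul_mul hr hχ.continuousOn hrI (hχ.integrableOn_hardy hk)
  have h4 : IntegrableOn (fun t => t ^ k * (deriv w t * deriv χ t - A t * (w t * χ t)))
      (Ioi 0) := by
    refine integrableOn_Ioi_of_abs_le ((continuousOn_rpow_Ioi k).mul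
      ((hw.continuousOn_deriv.mul hχ.continuousOn_deriv).sub
        (hA.mul (hw.continuousOn.mul hχ.continuousOn)))) (h1.abs.add (h2.abs.const_mul M))
      fun t ht => ?_
    have := Real.rpow_nonneg (le_of_lt ht) k
    simp only [Pi.add_apply, abs_mul, abs_of_nonneg this]
    calc t ^ k * |deriv w t * deriv χ t - A t * (w t * χ t)|
        ≤ t ^ k * (|deriv w t| * |deriv χ t| + M * (|w t| * |χ t|)) := by
          gcongr
          refine (abs_sub _ _).trans ?_
          rw [abs_mul, abs_mul, abs_mul]
          gcongr
          exact hM t ht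
      _ = _ := by ring
  have h5 : IntegrableOn (fun t => t⁻¹ * (t ^ k * deriv w t * χ t)) (Ioi 0) := by
    refine integrableOn_Ioi_of_abs_le ?_ (hw.integrableOn_deriv_sq.add
      (hχ.integrableOn_hardy hk)) fun t ht => ?_
    · exact (continuousOn_inv₀.mono fun t ht => ne_of_gt ht).mul
        (((continuousOn_rpow_Ioi k).mul hw.continuousOn_deriv).mul hχ.continuousOn)
    · have e2 : t ^ k = t ^ (k - 2) * t ^ 2 := by
        rw [← Real.rpow_natCast t 2, ← Real.rpow_add ht]; congr 1; norm_num
      have hp := Real.rpow_nonneg (le_of_lt ht) (k - 2)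
      have ht' : t ≠ 0 := ne_of_gt ht
      simp only [Pi.add_apply]
      rw [e2, show t⁻¹ * (t ^ (k - 2) * t ^ 2 * deriv w t * χ t) =
        t ^ (k - 2) * ((t * deriv w t) * χ t) by field_simp, abs_mul, abs_of_nonneg hp,
        show t ^ (k - 2) * t ^ 2 * deriv w t ^ 2 + t ^ (k - 2) * χ t ^ 2 =
          t ^ (k - 2) * ((t * deriv w t) ^ 2 + χ t ^ 2) by ring]
      gcongr
      rw [abs_le]
      constructor <;>
        nlinarith [sq_nonneg (t * deriv w t + χ t), sq_nonneg (t * deriv w t - χ t)]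
  have key := setIntegral_Ioi_eq_zero_of_hasDerivAt (g := fun t => t ^ k * deriv w t * χ t)
    (G := fun t => t ^ k * (deriv w t * deriv χ t - A t * (w t * χ t)) +
      t ^ (k - 2) * (r t * χ t)) ?_ (h4.add h3) h5
  · rw [integral_add h4 h3] at key
    linarith
  · intro t ht
    convert! ((Real.hasDerivAt_rpow_const (x := t) (p := k) (Or.inl (ne_of_gt ht))).mul
      (hw' t ht)).mul (hχ.hasDerivAt ht) using 1
    have e1 : t ^ (k - 1) = t ^ (k - 2) * t := by
      rw [← Real.rpow_add_one (ne_of_gt ht)]; congr 1; ring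
    have e2 : t ^ k = t ^ (k - 2) * t ^ 2 := by
      rw [← Real.rpow_natCast t 2, ← Real.rpow_add ht]; congr 1; norm_num
    have ht' : t ≠ 0 := ne_of_gt ht
    have : w'' t = r t / t ^ 2 - k / t * deriv w t - A t * w t := by linarith [heq t ht]
    simp only [this, e1, e2, Pi.mul_apply]
    field_simp
    ring

theorem setIntegral_rpow_mul_sq_pos {p : ℝ} {f : ℝ → ℝ} (hf : ContinuousOn f (Ioi 0))
    (hI : IntegrableOn (fun t => t ^ p * f t ^ 2) (Ioi 0)) (hne : ∃ t ∈ Ioi (0 : ℝ), f t ≠ 0) :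
    0 < ∫ t in Ioi (0 : ℝ), t ^ p * f t ^ 2 := by
  obtain ⟨t₀, ht₀, hft⟩ := hne
  have hpos : ∀ t ∈ Ioi (0 : ℝ), 0 < t ^ p := fun t ht => Real.rpow_pos_of_pos ht p
  rw [setIntegral_pos_iff_support_of_nonneg_ae _ hI]
  · have hopen : IsOpen (Ioi 0 ∩ (fun t => t ^ p * f t ^ 2) ⁻¹' {0}ᶜ) :=
      ContinuousOn.isOpen_inter_preimage ((continuousOn_rpow_Ioi p).mul (hf.pow 2)) isOpen_Ioi
        isOpen_compl_singleton
    refine (hopen.measure_pos volume ⟨t₀, ht₀, ?_⟩).trans_le (measure_mono ?_)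
    · simp [hft, (hpos t₀ ht₀).ne']
    · exact fun t ht => ⟨ht.2, ht.1⟩
  · refine (ae_restrict_iff' measurableSet_Ioi).2 (Eventually.of_forall fun t ht => ?_)
    have := hpos t ht
    simp only [Pi.zero_apply]; positivity

/-- An element of `E` solving `φ'' + (k/t) φ' + A φ = μ φ / t²`. -/
def SingularSol (k : ℝ) (A : ℝ → ℝ) (μ : ℝ) (φ : ℝ → ℝ) : Prop :=
  memE k φ ∧ (∀ t > (0 : ℝ), HasDerivAt (deriv φ) (deriv (deriv φ) t) t) ∧
  ∀ t > (0 : ℝ), deriv (deriv φ) t + k / t * deriv φ t + A t * φ t = μ * φ t / t ^ 2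

/-- Morse index one leaves room for at most one negative singular eigenvalue. -/
theorem MorseIndexOne.eq_zero_of_singularSol {k M μ₁ μ₂ : ℝ} (hk : 1 < k) {A φ₁ φ₂ : ℝ → ℝ}
    (hA : ContinuousOn A (Ioi 0)) (hM : ∀ t > (0 : ℝ), |A t| ≤ M) (hmorse : MorseIndexOne k A)
    (hμ₁ : 0 < μ₁) (hμ₂ : 0 < μ₂) (hne : μ₁ ≠ μ₂) (h₁ : SingularSol k A μ₁ φ₁)
    (h₂ : SingularSol k A μ₂ φ₂) (hφ₁ : ∃ t ∈ Ioi (0 : ℝ), φ₁ t ≠ 0) :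
    ∀ t > (0 : ℝ), φ₂ t = 0 := by
  by_contra! hφ₂
  obtain ⟨hE₁, hd₁, heq₁⟩ := h₁
  obtain ⟨hE₂, hd₂, heq₂⟩ := h₂
  have hH₁ := hE₁.integrableOn_hardy hk
  have hH₂ := hE₂.integrableOn_hardy hk
  have hderiv : ∀ c₁ c₂ : ℝ, ∀ t > (0 : ℝ), HasDerivAt (fun t => c₁ * φ₁ t + c₂ * φ₂ t)
      (c₁ * deriv φ₁ t + c₂ * deriv φ₂ t) t := fun c₁ c₂ t ht =>
    ((hE₁.hasDerivAt ht).const_mul c₁).add ((hE₂.hasDerivAt ht).const_mul c₂)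
  have hderiv' : ∀ c₁ c₂ : ℝ, ∀ t > (0 : ℝ),
      HasDerivAt (deriv (fun t => c₁ * φ₁ t + c₂ * φ₂ t))
      (c₁ * deriv (deriv φ₁) t + c₂ * deriv (deriv φ₂) t) t := fun c₁ c₂ t ht => by
    refine (((hd₁ t ht).const_mul c₁).add ((hd₂ t ht).const_mul c₂)).congr_of_eventuallyEq ?_
    filter_upwards [Ioi_mem_nhds ht] with s hs using (hderiv c₁ c₂ s hs).deriv
  have hindep : ∀ c₁ c₂ : ℝ, (∀ t ∈ Ioi (0 : ℝ), c₁ * φ₁ t + c₂ * φ₂ t = 0) →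
      c₁ = 0 ∧ c₂ = 0 := by
    intro c₁ c₂ h0
    have h1 : ∀ t > (0 : ℝ), c₁ * deriv φ₁ t + c₂ * deriv φ₂ t = 0 := fun t ht => by
      refine (hderiv c₁ c₂ t ht).unique ((hasDerivAt_const t (0 : ℝ)).congr_of_eventuallyEq ?_)
      filter_upwards [Ioi_mem_nhds ht] with s hs using h0 s hs
    have h2 : ∀ t > (0 : ℝ), c₁ * deriv (deriv φ₁) t + c₂ * deriv (deriv φ₂) t = 0 :=
      fun t ht => by
        refine (((hd₁ t ht).const_mul c₁).add ((hd₂ t ht).const_mul c₂)).unique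
          ((hasDerivAt_const t (0 : ℝ)).congr_of_eventuallyEq ?_)
        filter_upwards [Ioi_mem_nhds ht] with s hs using h1 s hs
    have h3 : ∀ t > (0 : ℝ), c₁ * μ₁ * φ₁ t + c₂ * μ₂ * φ₂ t = 0 := fun t ht => by
      have e₁ := heq₁ t ht
      have e₂ := heq₂ t ht
      have ht' : t ≠ 0 := ne_of_gt ht
      have : (c₁ * μ₁ * φ₁ t + c₂ * μ₂ * φ₂ t) / t ^ 2 = 0 := by
        rw [show (c₁ * μ₁ * φ₁ t + c₂ * μ₂ * φ₂ t) / t ^ 2 =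
          c₁ * (μ₁ * φ₁ t / t ^ 2) + c₂ * (μ₂ * φ₂ t / t ^ 2) by ring, ← e₁, ← e₂]
        linear_combination h2 t ht + k / t * h1 t ht + A t * h0 t ht
      simpa [ht'] using this
    obtain ⟨t₁, ht₁, hn₁⟩ := hφ₁
    obtain ⟨t₂, ht₂, hn₂⟩ := hφ₂
    have hne' : μ₁ - μ₂ ≠ 0 := sub_ne_zero.2 hne
    constructor
    · have : c₁ * ((μ₁ - μ₂) * φ₁ t₁) = 0 := by
        linear_combination h3 t₁ ht₁ - μ₂ * h0 t₁ ht₁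
      simpa [hne', hn₁] using this
    · have : c₂ * ((μ₁ - μ₂) * φ₂ t₂) = 0 := by
        linear_combination μ₁ * h0 t₂ ht₂ - h3 t₂ ht₂
      simpa [hne', hn₂] using this
  have hsq : ∀ {p μ : ℝ} {φ : ℝ → ℝ}, IntegrableOn (fun t => t ^ p * φ t ^ 2) (Ioi 0) →
      IntegrableOn (fun t => t ^ p * (μ * φ t) ^ 2) (Ioi 0) := by
    intro p μ φ h
    refine IntegrableOn.congr_fun (h.const_mul (μ ^ 2)) (fun t _ => ?_) measurableSet_Ioi
    ring
  have horth : ∫ t in Ioi (0 : ℝ), t ^ (k - 2) * (φ₁ t * φ₂ t) = 0 := by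
    have a := integral_weak_form hk hA hM hE₁ hd₁ (r := fun t => μ₁ * φ₁ t)
      (continuousOn_const.mul hE₁.continuousOn)
      (hsq hH₁) heq₁ hE₂
    have b := integral_weak_form hk hA hM hE₂ hd₂ (r := fun t => μ₂ * φ₂ t)
      (continuousOn_const.mul hE₂.continuousOn)
      (hsq hH₂) heq₂ hE₁
    have e₁ : ∀ t : ℝ, t ^ (k - 2) * (μ₁ * φ₁ t * φ₂ t) = μ₁ * (t ^ (k - 2) * (φ₁ t * φ₂ t)) :=
      fun t => by ring
    have e₂ : ∀ t : ℝ, t ^ (k - 2) * (μ₂ * φ₂ t * φ₁ t) = μ₂ * (t ^ (k - 2) * (φ₁ t * φ₂ t)) :=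
      fun t => by ring
    have e₃ : ∀ t : ℝ, t ^ k * (deriv φ₂ t * deriv φ₁ t - A t * (φ₂ t * φ₁ t)) =
        t ^ k * (deriv φ₁ t * deriv φ₂ t - A t * (φ₁ t * φ₂ t)) := fun t => by ring
    simp only [e₁, integral_const_mul] at a
    simp only [e₂, e₃, integral_const_mul] at b
    have : (μ₁ - μ₂) * ∫ t in Ioi (0 : ℝ), t ^ (k - 2) * (φ₁ t * φ₂ t) = 0 := by
      linear_combination a - b
    simpa [sub_ne_zero.2 hne] using this
  obtain ⟨c₁, c₂, hc, hR⟩ := hmorse.2 φ₁ φ₂ hE₁ hE₂ hindep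
  refine absurd hR (not_le.2 ?_)
  set w : ℝ → ℝ := fun t => c₁ * φ₁ t + c₂ * φ₂ t with hw
  have hwd : EqOn (deriv w) (fun t => c₁ * deriv φ₁ t + c₂ * deriv φ₂ t) (Ioi 0) :=
    fun t ht => (hderiv c₁ c₂ t ht).deriv
  have hlin : ∀ {p a b : ℝ} {f g : ℝ → ℝ}, ContinuousOn f (Ioi 0) → ContinuousOn g (Ioi 0) →
      IntegrableOn (fun t => t ^ p * f t ^ 2) (Ioi 0) →
      IntegrableOn (fun t => t ^ p * g t ^ 2) (Ioi 0) →
      IntegrableOn (fun t => t ^ p * (a * f t + b * g t) ^ 2) (Ioi 0) := by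
    intro p a b f g hf hg hf2 hg2
    refine IntegrableOn.congr_fun (((hf2.const_mul (a ^ 2)).add (hg2.const_mul (b ^ 2))).add
      ((integrableOn_rpow_mul_mul hf hg hf2 hg2).const_mul (2 * a * b)))
      (fun t _ => ?_) measurableSet_Ioi
    simp only [Pi.add_apply]
    ring
  have hwE : memE k w := by
    refine ⟨(contDiffOn_const.mul hE₁.1).add (contDiffOn_const.mul hE₂.1), ?_⟩
    refine ((hlin (a := c₁) (b := c₂) hE₁.continuousOn_deriv hE₂.continuousOn_deriv
      hE₁.integrableOn_deriv_sq hE₂.integrableOn_deriv_sq).add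
      (hlin (a := c₁) (b := c₂) hE₁.continuousOn hE₂.continuousOn
      hE₁.integrableOn_sq hE₂.integrableOn_sq)).congr_fun (fun t ht => ?_) measurableSet_Ioi
    simp only [Pi.add_apply]
    rw [hwd ht]
    ring
  have hne0 : ∃ t ∈ Ioi (0 : ℝ), w t ≠ 0 := by
    by_contra! h0
    exact hc (hindep c₁ c₂ h0)
  have hnum := integral_weak_form hk hA hM hwE (hderiv' c₁ c₂)
    (r := fun t => c₁ * μ₁ * φ₁ t + c₂ * μ₂ * φ₂ t)
    ((continuousOn_const.mul hE₁.continuousOn).add (continuousOn_const.mul hE₂.continuousOn))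
    (hlin hE₁.continuousOn hE₂.continuousOn hH₁ hH₂) (fun t ht => by
      rw [hwd ht]
      linear_combination c₁ * heq₁ t ht + c₂ * heq₂ t ht) hwE
  have hexp : ∫ t in Ioi (0 : ℝ), t ^ (k - 2) * ((c₁ * μ₁ * φ₁ t + c₂ * μ₂ * φ₂ t) * w t) =
      c₁ ^ 2 * μ₁ * (∫ t in Ioi (0 : ℝ), t ^ (k - 2) * φ₁ t ^ 2) +
      c₂ ^ 2 * μ₂ * (∫ t in Ioi (0 : ℝ), t ^ (k - 2) * φ₂ t ^ 2) := by
    have hI := integrableOn_rpow_mul_mul hE₁.continuousOn hE₂.continuousOn hH₁ hH₂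
    have e : ∀ t : ℝ, t ^ (k - 2) * ((c₁ * μ₁ * φ₁ t + c₂ * μ₂ * φ₂ t) * w t) =
        (c₁ ^ 2 * μ₁ * (t ^ (k - 2) * φ₁ t ^ 2) + c₂ ^ 2 * μ₂ * (t ^ (k - 2) * φ₂ t ^ 2)) +
        c₁ * c₂ * (μ₁ + μ₂) * (t ^ (k - 2) * (φ₁ t * φ₂ t)) := fun t => by
      simp only [hw]; ring
    simp only [e]
    have hs : IntegrableOn (fun t => c₁ ^ 2 * μ₁ * (t ^ (k - 2) * φ₁ t ^ 2) +
        c₂ ^ 2 * μ₂ * (t ^ (k - 2) * φ₂ t ^ 2)) (Ioi 0) :=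
      (hH₁.const_mul _).add (hH₂.const_mul _)
    rw [integral_add hs (hI.const_mul _),
      integral_add (hH₁.const_mul _) (hH₂.const_mul _), integral_const_mul, integral_const_mul,
      integral_const_mul, horth]
    ring
  have hI₁ := setIntegral_rpow_mul_sq_pos hE₁.continuousOn hH₁ hφ₁
  have hI₂ := setIntegral_rpow_mul_sq_pos hE₂.continuousOn hH₂ hφ₂
  have hden := setIntegral_rpow_mul_sq_pos hwE.continuousOn hwE.integrableOn_sq hne0
  refine div_neg_of_neg_of_pos ?_ hden
  have : ∀ t, t ^ k * (deriv w t ^ 2 - A t * w t ^ 2) =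
      t ^ k * (deriv w t * deriv w t - A t * (w t * w t)) := fun t => by ring
  simp only [this]
  rw [hnum, hexp, neg_lt_zero]
  rcases not_and_or.1 hc with h | h <;> positivity

section Parametric

variable {K : Type*} [TopologicalSpace K] [CompactSpace K] [MeasurableSpace K]
  [OpensMeasurableSpace K] {ν : Measure K} [IsFiniteMeasure ν]

theorem hasDerivAt_integral_of_compactSpace {U : Set ℝ} (hU : IsOpen U) {f f' : ℝ → K → ℝ}
    (hf : ∀ s ∈ U, Continuous (f s)) (hf' : ContinuousOn (Function.uncurry f') (U ×ˢ univ))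
    (hd : ∀ s ∈ U, ∀ θ, HasDerivAt (fun r => f r θ) (f' s θ) s) {s : ℝ} (hs : s ∈ U) :
    HasDerivAt (fun r => ∫ θ, f r θ ∂ν) (∫ θ, f' s θ ∂ν) s := by
  obtain ⟨ε, hε, hεU⟩ := Metric.nhds_basis_closedBall.mem_iff.1 (hU.mem_nhds hs)
  obtain ⟨M, hM⟩ := ((isCompact_closedBall s ε).prod isCompact_univ).exists_bound_of_continuousOn
    (hf'.mono (prod_mono hεU (subset_refl (univ : Set K))))
  have hcont : Continuous (f' s) :=
    hf'.comp_continuous (by fun_prop : Continuous fun θ : K => (s, θ)) fun θ => ⟨hs, mem_univ _⟩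
  refine (hasDerivAt_integral_of_dominated_loc_of_deriv_le (bound := fun _ => M)
    (Metric.closedBall_mem_nhds s hε) ?_ ?_ hcont.aestronglyMeasurable ?_ (integrable_const _) ?_).2
  · filter_upwards [hU.mem_nhds hs] with r hr using (hf r hr).aestronglyMeasurable
  · exact (hf s hs).integrable_of_hasCompactSupport (HasCompactSupport.of_compactSpace _)
  · exact ae_of_all _ fun θ r hr => hM (r, θ) ⟨hr, mem_univ _⟩
  · exact ae_of_all _ fun θ r hr => hd r (hεU hr) θ

theorem continuousOn_integral_of_compactSpace {U : Set ℝ} {f : ℝ → K → ℝ}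
    (hf : ContinuousOn (Function.uncurry f) (U ×ˢ univ)) :
    ContinuousOn (fun r => ∫ θ, f r θ ∂ν) U :=
  continuousOn_integral_of_compact_support isCompact_univ hf fun _ _ _ h => absurd (mem_univ _) h

theorem Continuous.integrable_of_compactSpace {f : K → ℝ} (hf : Continuous f) :
    Integrable f ν :=
  hf.integrable_of_hasCompactSupport (HasCompactSupport.of_compactSpace _)

end Parametric

section Sphere

open scoped RealInnerProductSpace Pointwise

variable {E : Type*} [NormedAddCommGroup E] [InnerProductSpace ℝ E]

/-- The rotation by the angle `φ` in the plane spanned by `a` and `b`. -/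
noncomputable def planeRot (a b : E) (φ : ℝ) : E →ₗ[ℝ] E where
  toFun x := x + ((Real.cos φ - 1) * ⟪a, x⟫ - Real.sin φ * ⟪b, x⟫) • a +
    ((Real.cos φ - 1) * ⟪b, x⟫ + Real.sin φ * ⟪a, x⟫) • b
  map_add' x y := by simp only [inner_add_right]; module
  map_smul' c x := by simp only [inner_smul_right, RingHom.id_apply]; module

theorem planeRot_apply (a b : E) (φ : ℝ) (x : E) :
    planeRot a b φ x = x + ((Real.cos φ - 1) * ⟪a, x⟫ - Real.sin φ * ⟪b, x⟫) • a +
      ((Real.cos φ - 1) * ⟪b, x⟫ + Real.sin φ * ⟪a, x⟫) • b := rfl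

theorem norm_planeRot {a b : E} (ha : ‖a‖ = 1) (hb : ‖b‖ = 1) (hab : ⟪a, b⟫ = 0) (φ : ℝ) (x : E) :
    ‖planeRot a b φ x‖ = ‖x‖ := by
  refine (sq_eq_sq₀ (norm_nonneg _) (norm_nonneg _)).1 ?_
  have hba : ⟪b, a⟫ = 0 := by rw [real_inner_comm, hab]
  have haa : ⟪a, a⟫ = 1 := by rw [real_inner_self_eq_norm_sq, ha]; norm_num
  have hbb : ⟪b, b⟫ = 1 := by rw [real_inner_self_eq_norm_sq, hb]; norm_num
  rw [← real_inner_self_eq_norm_sq, ← real_inner_self_eq_norm_sq, planeRot_apply]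
  simp only [inner_add_right, inner_add_left, inner_smul_left, inner_smul_right, hab, hba, haa,
    hbb, real_inner_comm x a, real_inner_comm x b, RCLike.conj_to_real]
  linear_combination (⟪x, a⟫ ^ 2 + ⟪x, b⟫ ^ 2) * Real.sin_sq_add_cos_sq φ

/-- The derivative of `planeRot a b φ x` with respect to `φ`. -/
noncomputable def planeRotDeriv (a b : E) (φ : ℝ) (x : E) : E :=
  (-Real.sin φ * ⟪a, x⟫ - Real.cos φ * ⟪b, x⟫) • a +
    (-Real.sin φ * ⟪b, x⟫ + Real.cos φ * ⟪a, x⟫) • b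

theorem hasDerivAt_planeRot (a b : E) (φ : ℝ) (x : E) :
    HasDerivAt (fun r => planeRot a b r x) (planeRotDeriv a b φ x) φ := by
  simp only [planeRot_apply]
  have h₁ := (((Real.hasDerivAt_cos φ).sub_const 1).mul_const ⟪a, x⟫).sub
    ((Real.hasDerivAt_sin φ).mul_const ⟪b, x⟫)
  have h₂ := (((Real.hasDerivAt_cos φ).sub_const 1).mul_const ⟪b, x⟫).add
    ((Real.hasDerivAt_sin φ).mul_const ⟪a, x⟫)
  exact ((h₁.smul_const a).const_add x).add (h₂.smul_const b)

theorem Continuous.planeRot {X : Type*} [TopologicalSpace X] (a b : E) {φ : X → ℝ} {x : X → E}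
    (hφ : Continuous φ) (hx : Continuous x) : Continuous fun p => planeRot a b (φ p) (x p) := by
  simp only [planeRot_apply]; fun_prop

theorem Continuous.planeRotDeriv {X : Type*} [TopologicalSpace X] (a b : E) {φ : X → ℝ} {x : X → E}
    (hφ : Continuous φ) (hx : Continuous x) :
    Continuous fun p => planeRotDeriv a b (φ p) (x p) := by
  simp only [_root_.planeRotDeriv]; fun_prop

variable [FiniteDimensional ℝ E]

/-- `planeRot` for orthonormal `a`, `b`, as a linear isometry. -/
noncomputable def planeRotIso {a b : E} (ha : ‖a‖ = 1) (hb : ‖b‖ = 1) (hab : ⟪a, b⟫ = 0) (φ : ℝ) :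
    E ≃ₗᵢ[ℝ] E :=
  LinearIsometry.toLinearIsometryEquiv ⟨planeRot a b φ, norm_planeRot ha hb hab φ⟩ rfl

variable [MeasurableSpace E] [BorelSpace E]

theorem integral_toSphere_comp (L : E ≃ₗᵢ[ℝ] E) (f : E → ℝ) :
    ∫ θ : Metric.sphere (0 : E) 1, f (L θ) ∂(volume : Measure E).toSphere =
      ∫ θ : Metric.sphere (0 : E) 1, f θ ∂(volume : Measure E).toSphere := by
  let T : Metric.sphere (0 : E) 1 ≃ₜ Metric.sphere (0 : E) 1 :=
    { toFun := fun θ => ⟨L θ, by simp⟩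
      invFun := fun θ => ⟨L.symm θ, by simp⟩
      left_inv := fun θ => by simp
      right_inv := fun θ => by simp
      continuous_toFun := by fun_prop
      continuous_invFun := by fun_prop }
  have hT : MeasurePreserving T (volume : Measure E).toSphere (volume : Measure E).toSphere := by
    refine ⟨T.continuous.measurable, ?_⟩
    ext s hs
    rw [Measure.map_apply T.continuous.measurable hs, Measure.toSphere_apply' _ hs,
      Measure.toSphere_apply' _ (T.continuous.measurable hs)]
    congr 1
    rw [← L.measurePreserving.measure_preimage_equiv (f := L.toHomeomorph.toMeasurableEquiv)
      (Ioo (0 : ℝ) 1 • ((↑) '' s : Set E))]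
    congr 1
    ext x
    change _ ↔ L x ∈ Ioo (0 : ℝ) 1 • ((↑) '' s : Set E)
    simp only [Set.mem_smul, mem_preimage, mem_image, Subtype.exists]
    constructor
    · rintro ⟨r, hr, y, ⟨z, hz, hzs, rfl⟩, rfl⟩
      exact ⟨r, hr, L z, ⟨L z, by simpa using hz, hzs, rfl⟩, (map_smul L r z).symm⟩
    · rintro ⟨r, hr, y, ⟨z, hz, hzs, rfl⟩, hy⟩
      refine ⟨r, hr, L.symm z, ⟨L.symm z, by simpa using hz, ?_, rfl⟩, ?_⟩
      · simpa [T] using hzs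
      · apply L.injective
        simpa using hy
  exact hT.integral_comp T.measurableEmbedding (fun θ => f θ)

end Sphere

section Sphere

open scoped RealInnerProductSpace

variable {E : Type*} [NormedAddCommGroup E] [InnerProductSpace ℝ E] [FiniteDimensional ℝ E]
  [MeasurableSpace E] [BorelSpace E]

theorem integral_sphere_fderiv_rotation {f : E → ℝ} (hf : ContDiffOn ℝ 1 f {x | x ≠ 0}) {a b : E}
    (ha : ‖a‖ = 1) (hb : ‖b‖ = 1) (hab : ⟪a, b⟫ = 0) :
    ∫ θ : Metric.sphere (0 : E) 1, fderiv ℝ f θ (⟪a, (θ : E)⟫ • b - ⟪b, (θ : E)⟫ • a)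
      ∂(volume : Measure E).toSphere = 0 := by
  have hopen : IsOpen {x : E | x ≠ 0} := isOpen_ne
  have hdf : ∀ x : E, x ≠ 0 → HasFDerivAt f (fderiv ℝ f x) x := fun x hx =>
    ((hf.differentiableOn one_ne_zero).differentiableAt (hopen.mem_nhds hx)).hasFDerivAt
  have hne : ∀ (φ : ℝ) (θ : Metric.sphere (0 : E) 1), planeRot a b φ θ ≠ 0 := fun φ θ => by
    rw [← norm_ne_zero_iff, norm_planeRot ha hb hab]; simp
  have hp : Continuous fun p : ℝ × Metric.sphere (0 : E) 1 => (p.2 : E) :=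
    continuous_subtype_val.comp continuous_snd
  have hc : Continuous fun p : ℝ × Metric.sphere (0 : E) 1 => planeRot a b p.1 (p.2 : E) :=
    continuous_fst.planeRot a b hp
  have hc' : Continuous fun p : ℝ × Metric.sphere (0 : E) 1 => planeRotDeriv a b p.1 (p.2 : E) :=
    continuous_fst.planeRotDeriv a b hp
  have hfd : ContinuousOn (fderiv ℝ f) {x | x ≠ 0} := hf.continuousOn_fderiv_of_isOpen hopen le_rfl
  have h₁ : ∀ φ : ℝ, Continuous fun θ : Metric.sphere (0 : E) 1 => f (planeRot a b φ θ) := fun φ =>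
    hf.continuousOn.comp_continuous
      (Continuous.planeRot a b (continuous_const (y := φ)) continuous_subtype_val) (hne φ)
  have h₂ : Continuous fun p : ℝ × Metric.sphere (0 : E) 1 =>
      fderiv ℝ f (planeRot a b p.1 (p.2 : E)) (planeRotDeriv a b p.1 (p.2 : E)) :=
    (hfd.comp_continuous hc fun p => hne p.1 p.2).clm_apply hc'
  have hd : ∀ (φ : ℝ) (θ : Metric.sphere (0 : E) 1), HasDerivAt (fun r => f (planeRot a b r θ))
      (fderiv ℝ f (planeRot a b φ θ) (planeRotDeriv a b φ θ)) φ := fun φ θ =>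
    (hdf _ (hne φ θ)).comp_hasDerivAt φ (hasDerivAt_planeRot a b φ θ)
  have key := hasDerivAt_integral_of_compactSpace (ν := (volume : Measure E).toSphere) isOpen_univ
      (f' := fun φ (θ : Metric.sphere (0 : E) 1) =>
        fderiv ℝ f (planeRot a b φ θ) (planeRotDeriv a b φ θ))
      (fun φ _ => h₁ φ) (Continuous.continuousOn h₂) (fun φ _ θ => hd φ θ) (mem_univ (0 : ℝ))
  have hconst : (fun φ => ∫ θ : Metric.sphere (0 : E) 1, f (planeRot a b φ θ)
      ∂(volume : Measure E).toSphere) = fun _ => ∫ θ : Metric.sphere (0 : E) 1, f θ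
      ∂(volume : Measure E).toSphere := funext fun φ =>
    integral_toSphere_comp (planeRotIso ha hb hab φ) f
  rw [hconst] at key
  rw [← key.unique (hasDerivAt_const _ _)]
  refine integral_congr_ae (ae_of_all _ fun θ => ?_)
  have h₀ : planeRot a b 0 (θ : E) = θ := by simp [planeRot_apply]
  have h₀' : planeRotDeriv a b 0 (θ : E) = ⟪a, (θ : E)⟫ • b - ⟪b, (θ : E)⟫ • a := by
    simp [planeRotDeriv, sub_eq_add_neg, add_comm]
  simp only [h₀, h₀']

end Sphere

section AngularLaplacian

open scoped RealInnerProductSpace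

theorem continuous_restrict_sphere {E : Type*} [NormedAddCommGroup E] {g : E → ℝ} (hg : ContinuousOn g {x | x ≠ 0}) :
    Continuous fun θ : Metric.sphere (0 : E) 1 => g θ :=
  hg.comp_continuous continuous_subtype_val fun θ => by
    simpa using ne_zero_of_mem_unit_sphere θ

section General

variable {E : Type*} [NormedAddCommGroup E] [InnerProductSpace ℝ E]

/-- The infinitesimal rotation `x ↦ ⟪a, x⟫ b - ⟪b, x⟫ a`. -/
noncomputable def rotGen (a b : E) : E →L[ℝ] E :=
  (innerSL ℝ a).smulRight b - (innerSL ℝ b).smulRight a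

theorem rotGen_apply (a b x : E) : rotGen a b x = ⟪a, x⟫ • b - ⟪b, x⟫ • a := by
  simp [rotGen]

/-- The derivative of `u` along the linear vector field `J`. -/
noncomputable def lieDer (J : E →L[ℝ] E) (u : E → ℝ) (x : E) : ℝ := fderiv ℝ u x (J x)

variable {J : E →L[ℝ] E} {u p : E → ℝ}

theorem ContDiffOn.hasFDerivAt_of_ne {F : Type*} [NormedAddCommGroup F] [NormedSpace ℝ F]
    {g : E → F} (hg : ContDiffOn ℝ 1 g {x | x ≠ 0}) {x : E} (hx : x ≠ 0) :
    HasFDerivAt g (fderiv ℝ g x) x :=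
  ((hg.differentiableOn one_ne_zero).differentiableAt (isOpen_ne.mem_nhds hx)).hasFDerivAt

theorem ContDiffOn.fderiv_of_ne (hu : ContDiffOn ℝ 2 u {x | x ≠ 0}) :
    ContDiffOn ℝ 1 (fderiv ℝ u) {x | x ≠ 0} :=
  hu.fderiv_of_isOpen isOpen_ne (by norm_num)

theorem ContDiffOn.lieDer (hu : ContDiffOn ℝ 2 u {x | x ≠ 0}) :
    ContDiffOn ℝ 1 (lieDer J u) {x | x ≠ 0} :=
  hu.fderiv_of_ne.clm_apply J.contDiff.contDiffOn

theorem fderiv_lieDer (hu : ContDiffOn ℝ 2 u {x | x ≠ 0}) {x : E} (hx : x ≠ 0) (v : E) :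
    fderiv ℝ (lieDer J u) x v = fderiv ℝ (fderiv ℝ u) x v (J x) + fderiv ℝ u x (J v) := by
  have h := (hu.fderiv_of_ne.hasFDerivAt_of_ne hx).clm_apply J.hasFDerivAt
  have : fderiv ℝ (lieDer J u) x = _ := h.fderiv
  rw [this]
  simp [add_comm]

theorem continuousOn_lieDer_lieDer (hu : ContDiffOn ℝ 2 u {x | x ≠ 0}) :
    ContinuousOn (lieDer J (lieDer J u)) {x | x ≠ 0} :=
  ((hu.lieDer (J := J)).continuousOn_fderiv_of_isOpen isOpen_ne le_rfl).clm_apply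
    J.continuous.continuousOn

variable [FiniteDimensional ℝ E] [MeasurableSpace E] [BorelSpace E]

theorem integral_sphere_lieDer_lieDer_mul (hu : ContDiffOn ℝ 2 u {x | x ≠ 0})
    (hp : ContDiffOn ℝ 2 p {x | x ≠ 0}) {a b : E} (ha : ‖a‖ = 1) (hb : ‖b‖ = 1)
    (hab : ⟪a, b⟫ = 0) :
    ∫ θ : Metric.sphere (0 : E) 1, lieDer (rotGen a b) (lieDer (rotGen a b) u) θ * p θ
      ∂(volume : Measure E).toSphere =
    ∫ θ : Metric.sphere (0 : E) 1, u θ * lieDer (rotGen a b) (lieDer (rotGen a b) p) θ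
      ∂(volume : Measure E).toSphere := by
  set J := rotGen a b
  have h21 : (1 : WithTop ℕ∞) ≤ 2 := one_le_two
  have key := integral_sphere_fderiv_rotation (f := fun x => lieDer J u x * p x - u x * lieDer J p x)
    ((hu.lieDer.mul (hp.of_le h21)).sub ((hu.of_le h21).mul hp.lieDer)) ha hb hab
  rw [← sub_eq_zero, ← integral_sub]
  · rw [← key]
    refine integral_congr_ae (ae_of_all _ fun θ => ?_)
    have hθ : (θ : E) ≠ 0 := ne_zero_of_mem_unit_sphere θ
    have h := ((hu.lieDer (J := J)).hasFDerivAt_of_ne hθ).mul ((hp.of_le h21).hasFDerivAt_of_ne hθ)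
      |>.sub (((hu.of_le h21).hasFDerivAt_of_ne hθ).mul ((hp.lieDer (J := J)).hasFDerivAt_of_ne hθ))
    have h' : fderiv ℝ (fun x => lieDer J u x * p x - u x * lieDer J p x) (θ : E) = _ := h.fderiv
    simp only [← rotGen_apply, h']
    simp [lieDer, J]
    ring
  · exact ((continuous_restrict_sphere (continuousOn_lieDer_lieDer hu)).mul
      (continuous_restrict_sphere hp.continuousOn)).integrable_of_compactSpace
  · exact ((continuous_restrict_sphere hu.continuousOn).mul
      (continuous_restrict_sphere (continuousOn_lieDer_lieDer hp))).integrable_of_compactSpace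

end General

variable {N : ℕ} {u p : EuclideanSpace ℝ (Fin N) → ℝ}

/-- The operator `|x|² Δ - D²u(x)[x, x] - (N - 1) Du(x)[x]`, which restricts to the
Laplace–Beltrami operator on the unit sphere. -/
noncomputable def angLap (u : EuclideanSpace ℝ (Fin N) → ℝ) (x : EuclideanSpace ℝ (Fin N)) : ℝ :=
  ‖x‖ ^ 2 * lap u x - fderiv ℝ (fderiv ℝ u) x x x - (N - 1) * fderiv ℝ u x x

theorem lap_eq_sum (hu : ContDiffOn ℝ 2 u {x | x ≠ 0}) {x : EuclideanSpace ℝ (Fin N)}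
    (hx : x ≠ 0) : lap u x = ∑ i : Fin N, fderiv ℝ (fderiv ℝ u) x (EuclideanSpace.single i 1)
      (EuclideanSpace.single i 1) := by
  refine Finset.sum_congr rfl fun i _ => ?_
  have h := (hu.fderiv_of_ne.hasFDerivAt_of_ne hx).clm_apply
    (hasFDerivAt_const (EuclideanSpace.single i (1 : ℝ)) x)
  rw [h.fderiv]
  simp

theorem sum_lieDer_lieDer (hu : ContDiffOn ℝ 2 u {x | x ≠ 0}) {x : EuclideanSpace ℝ (Fin N)}
    (hx : x ≠ 0) :
    ∑ i : Fin N, ∑ j : Fin N,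
      lieDer (rotGen (EuclideanSpace.single i (1 : ℝ)) (EuclideanSpace.single j 1))
        (lieDer (rotGen (EuclideanSpace.single i 1) (EuclideanSpace.single j 1)) u) x =
      2 * angLap u x := by
  have hx' : x = ∑ i, x i • EuclideanSpace.single i (1 : ℝ) := by
    ext j
    simp [Finset.sum_apply, Pi.single_apply]
  have hn : ‖x‖ ^ 2 = ∑ i, x i ^ 2 := EuclideanSpace.real_norm_sq_eq x
  have hG : fderiv ℝ u x x = ∑ i, x i * fderiv ℝ u x (EuclideanSpace.single i 1) := by
    calc fderiv ℝ u x x = fderiv ℝ u x (∑ i, x i • EuclideanSpace.single i (1 : ℝ)) := by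
          rw [← hx']
      _ = _ := by simp only [map_sum, map_smul, smul_eq_mul]
  have hH : fderiv ℝ (fderiv ℝ u) x x x = ∑ i, ∑ j, x i * x j *
      fderiv ℝ (fderiv ℝ u) x (EuclideanSpace.single i 1) (EuclideanSpace.single j 1) := by
    calc fderiv ℝ (fderiv ℝ u) x x x = fderiv ℝ (fderiv ℝ u) x
          (∑ i, x i • EuclideanSpace.single i (1 : ℝ))
          (∑ i, x i • EuclideanSpace.single i (1 : ℝ)) := by rw [← hx']
      _ = _ := by
        simp only [map_sum, map_smul, smul_eq_mul, sum_apply,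
          smul_apply, Finset.mul_sum]
        rw [Finset.sum_comm]
        simp only [mul_assoc, mul_left_comm]
  rw [angLap, lap_eq_sum hu hx, hn, hG, hH]
  generalize hh : (fun i j => fderiv ℝ (fderiv ℝ u) x (EuclideanSpace.single i 1)
    (EuclideanSpace.single j (1 : ℝ))) = h
  generalize hg : (fun i => fderiv ℝ u x (EuclideanSpace.single i (1 : ℝ))) = g
  have hh' : ∀ i j, fderiv ℝ (fderiv ℝ u) x (EuclideanSpace.single i 1)
    (EuclideanSpace.single j (1 : ℝ)) = h i j := fun i j => congrFun (congrFun hh i) j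
  have hg' : ∀ i, fderiv ℝ u x (EuclideanSpace.single i (1 : ℝ)) = g i := fun i => congrFun hg i
  simp only [hh', hg']
  have hterm : ∀ i j : Fin N,
      lieDer (rotGen (EuclideanSpace.single i (1 : ℝ)) (EuclideanSpace.single j 1))
        (lieDer (rotGen (EuclideanSpace.single i 1) (EuclideanSpace.single j 1)) u) x =
      x i ^ 2 * h j j - x i * x j * h j i - x i * x j * h i j + x j ^ 2 * h i i
        - x j * g j - x i * g i + if i = j then x i * g i + x i * g i else 0 := by
    intro i j
    rw [lieDer, fderiv_lieDer hu hx]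
    simp only [rotGen_apply, map_sub, map_smul, EuclideanSpace.inner_single_left,
      sub_apply, smul_apply, hh', hg']
    rcases eq_or_ne i j with rfl | hij
    · simp
      ring
    · simp [hij, hij.symm]
      ring
  have hswap : ∑ i, ∑ j, x i * x j * h j i = ∑ i, ∑ j, x i * x j * h i j := by
    rw [Finset.sum_comm]
    simp only [mul_comm (x _) (x _)]
  simp only [hterm, Finset.sum_add_distrib, Finset.sum_sub_distrib, hswap, Finset.sum_ite_eq,
    Finset.mem_univ, if_true, Finset.sum_const, Finset.card_univ, Fintype.card_fin, nsmul_eq_mul,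
    ← Finset.mul_sum, ← Finset.sum_mul]
  ring

end AngularLaplacian

section Ridge

open scoped RealInnerProductSpace

variable {N : ℕ}

/-- The surface measure on the unit sphere of `ℝ^N`. -/
noncomputable abbrev sphereVol (N : ℕ) :
    Measure (Metric.sphere (0 : EuclideanSpace ℝ (Fin N)) 1) :=
  (volume : Measure (EuclideanSpace ℝ (Fin N))).toSphere

theorem integral_angLap_mul {u p : EuclideanSpace ℝ (Fin N) → ℝ}
    (hu : ContDiffOn ℝ 2 u {x | x ≠ 0}) (hp : ContDiffOn ℝ 2 p {x | x ≠ 0}) :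
    ∫ θ, angLap u θ * p θ ∂sphereVol N = ∫ θ, u θ * angLap p θ ∂sphereVol N := by
  have hcu := continuous_restrict_sphere hu.continuousOn
  have hcp := continuous_restrict_sphere hp.continuousOn
  have key : ∫ θ : Metric.sphere (0 : EuclideanSpace ℝ (Fin N)) 1, (∑ i : Fin N, ∑ j : Fin N,
      lieDer (rotGen (EuclideanSpace.single i (1 : ℝ)) (EuclideanSpace.single j 1))
        (lieDer (rotGen (EuclideanSpace.single i 1) (EuclideanSpace.single j 1)) u) θ) * p θ
        ∂sphereVol N =
      ∫ θ : Metric.sphere (0 : EuclideanSpace ℝ (Fin N)) 1, u θ * (∑ i : Fin N, ∑ j : Fin N,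
      lieDer (rotGen (EuclideanSpace.single i (1 : ℝ)) (EuclideanSpace.single j 1))
        (lieDer (rotGen (EuclideanSpace.single i 1) (EuclideanSpace.single j 1)) p) θ)
        ∂sphereVol N := by
    simp only [Finset.sum_mul, Finset.mul_sum]
    have h₁ : ∀ i j : Fin N, Integrable (fun θ : Metric.sphere (0 : EuclideanSpace ℝ (Fin N)) 1 =>
        lieDer (rotGen (EuclideanSpace.single i (1 : ℝ)) (EuclideanSpace.single j 1))
        (lieDer (rotGen (EuclideanSpace.single i 1) (EuclideanSpace.single j 1)) u) θ * p θ)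
        (sphereVol N) := fun i j =>
      ((continuous_restrict_sphere (continuousOn_lieDer_lieDer hu)).mul
        hcp).integrable_of_compactSpace
    have h₂ : ∀ i j : Fin N, Integrable (fun θ : Metric.sphere (0 : EuclideanSpace ℝ (Fin N)) 1 =>
        u θ * lieDer (rotGen (EuclideanSpace.single i (1 : ℝ)) (EuclideanSpace.single j 1))
        (lieDer (rotGen (EuclideanSpace.single i 1) (EuclideanSpace.single j 1)) p) θ)
        (sphereVol N) := fun i j =>
      (hcu.mul (continuous_restrict_sphere
        (continuousOn_lieDer_lieDer hp))).integrable_of_compactSpace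
    rw [integral_finsetSum _ fun i _ => integrable_finsetSum _ fun j _ => h₁ i j,
      integral_finsetSum _ fun i _ => integrable_finsetSum _ fun j _ => h₂ i j]
    refine Finset.sum_congr rfl fun i _ => ?_
    rw [integral_finsetSum _ fun j _ => h₁ i j, integral_finsetSum _ fun j _ => h₂ i j]
    refine Finset.sum_congr rfl fun j _ => ?_
    rcases eq_or_ne i j with rfl | hij
    · simp [lieDer, rotGen]
    · exact integral_sphere_lieDer_lieDer_mul hu hp (by simp) (by simp)
        (by simp [EuclideanSpace.inner_single_left, hij])
  have hs : ∀ θ : Metric.sphere (0 : EuclideanSpace ℝ (Fin N)) 1,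
      (θ : EuclideanSpace ℝ (Fin N)) ≠ 0 := fun θ => ne_zero_of_mem_unit_sphere θ
  simp only [sum_lieDer_lieDer hu (hs _), sum_lieDer_lieDer hp (hs _), mul_left_comm _ (2 : ℝ),
    mul_assoc (2 : ℝ), integral_const_mul] at key
  linarith

/-- The ridge polynomial `⟪v, x⟫ ^ d` shifted by its mean over the unit sphere. -/
noncomputable def ridge (v : EuclideanSpace ℝ (Fin N)) (d : ℕ) (x : EuclideanSpace ℝ (Fin N)) : ℝ :=
  ⟪v, x⟫ ^ d - (∫ θ, ⟪v, (θ : EuclideanSpace ℝ (Fin N))⟫ ^ d ∂sphereVol N) /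
    (sphereVol N).real univ

theorem contDiff_ridge (v : EuclideanSpace ℝ (Fin N)) (d : ℕ) : ContDiff ℝ 2 (ridge v d) := by
  exact ((innerSL ℝ v).contDiff.pow d).sub contDiff_const

theorem fderiv_ridge (v : EuclideanSpace ℝ (Fin N)) (d : ℕ) :
    fderiv ℝ (ridge v d) = fun x => (d * ⟪v, x⟫ ^ (d - 1)) • innerSL ℝ v := by
  funext x
  have h : HasFDerivAt (fun y => ⟪v, y⟫) (innerSL ℝ v) x := (innerSL ℝ v).hasFDerivAt
  have := (h.pow d).sub_const ((∫ θ, ⟪v, (θ : EuclideanSpace ℝ (Fin N))⟫ ^ d ∂sphereVol N) /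
    (sphereVol N).real univ)
  convert! this.fderiv using 1
  simp

theorem fderiv_fderiv_ridge (v : EuclideanSpace ℝ (Fin N)) (d : ℕ)
    (x a b : EuclideanSpace ℝ (Fin N)) : fderiv ℝ (fderiv ℝ (ridge v d)) x a b =
      d * (d - 1) * ⟪v, x⟫ ^ (d - 2) * ⟪v, a⟫ * ⟪v, b⟫ := by
  rw [fderiv_ridge]
  have h : HasFDerivAt (fun y => ⟪v, y⟫) (innerSL ℝ v) x := (innerSL ℝ v).hasFDerivAt
  have h' := (((h.pow (d - 1)).const_mul (d : ℝ)).smul_const (innerSL ℝ v)).fderiv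
  rw [h']
  rcases d with _ | d
  · simp
  · have e : d + 1 - 2 = d - 1 := by omega
    simp only [e, Nat.add_sub_cancel, Nat.cast_add, Nat.cast_one, add_sub_cancel_right,
      ContinuousLinearMap.smulRight_apply, smul_apply, innerSL_apply_apply, smul_eq_mul,
      nsmul_eq_mul]
    ring

theorem angLap_ridge_eq_inner_pow (v : EuclideanSpace ℝ (Fin N)) (d : ℕ)
    {x : EuclideanSpace ℝ (Fin N)} (hx : ‖x‖ = 1) :
    angLap (ridge v d) x = d * (d - 1) * ‖v‖ ^ 2 * ⟪v, x⟫ ^ (d - 2) -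
      d * (d + N - 2) * ⟪v, x⟫ ^ d := by
  have hx0 : x ≠ 0 := by rintro rfl; simp at hx
  rw [angLap, lap_eq_sum (contDiff_ridge v d).contDiffOn hx0, hx]
  simp only [fderiv_fderiv_ridge]
  rw [fderiv_ridge, EuclideanSpace.real_norm_sq_eq v]
  simp only [mul_assoc, ← Finset.mul_sum]
  rcases d with _ | _ | d
  · simp
  · simp
    left
    ring
  · simp [EuclideanSpace.inner_single_right, ← sq]
    ring

theorem angLap_const (c : ℝ) : angLap (fun _ : EuclideanSpace ℝ (Fin N) => c) = 0 := by
  funext x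
  simp [angLap, lap]

theorem sphereVol_univ_pos (hN : 0 < N) : 0 < (sphereVol N).real univ := by
  have : Nonempty (Fin N) := ⟨⟨0, hN⟩⟩
  have : NeZero (sphereVol N) := ⟨Measure.toSphere_ne_zero _⟩
  exact measureReal_univ_pos

theorem angLap_ridge (hN : 0 < N) (v : EuclideanSpace ℝ (Fin N)) (d : ℕ)
    {x : EuclideanSpace ℝ (Fin N)} (hx : ‖x‖ = 1) :
    angLap (ridge v d) x = d * (d - 1) * ‖v‖ ^ 2 * ridge v (d - 2) x -
      d * (d + N - 2) * ridge v d x := by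
  have hM := sphereVol_univ_pos hN
  have h := integral_angLap_mul (contDiffOn_const (c := (1 : ℝ)))
    (contDiff_ridge v d).contDiffOn
  have hi : ∀ n : ℕ, Integrable (fun θ : Metric.sphere (0 : EuclideanSpace ℝ (Fin N)) 1 =>
      ⟪v, (θ : EuclideanSpace ℝ (Fin N))⟫ ^ n) (sphereVol N) := fun n =>
    Continuous.integrable_of_compactSpace (by fun_prop)
  have hs : ∀ θ : Metric.sphere (0 : EuclideanSpace ℝ (Fin N)) 1,
    ‖(θ : EuclideanSpace ℝ (Fin N))‖ = 1 := fun θ => norm_eq_of_mem_sphere θ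
  simp only [angLap_const, Pi.zero_apply, zero_mul, integral_zero, one_mul,
    angLap_ridge_eq_inner_pow v d (hs _)] at h
  rw [integral_sub ((hi _).const_mul _) ((hi _).const_mul _), integral_const_mul,
    integral_const_mul] at h
  rw [angLap_ridge_eq_inner_pow v d hx, ridge, ridge]
  field_simp
  linear_combination -h

end Ridge

section SphereMean

open scoped RealInnerProductSpace

variable {N : ℕ}

/-- The moment `∫ w(sθ) p(θ) dσ(θ)` over the unit sphere. -/
noncomputable def sphMoment (w p : EuclideanSpace ℝ (Fin N) → ℝ) (s : ℝ) : ℝ :=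
  ∫ θ : Metric.sphere (0 : EuclideanSpace ℝ (Fin N)) 1, w (s • (θ : EuclideanSpace ℝ (Fin N))) * p θ
    ∂sphereVol N

/-- The first derivative of `sphMoment w p`. -/
noncomputable def sphMoment₁ (w p : EuclideanSpace ℝ (Fin N) → ℝ) (s : ℝ) : ℝ :=
  ∫ θ : Metric.sphere (0 : EuclideanSpace ℝ (Fin N)) 1,
    fderiv ℝ w (s • (θ : EuclideanSpace ℝ (Fin N))) θ * p θ ∂sphereVol N

/-- The second derivative of `sphMoment w p`. -/
noncomputable def sphMoment₂ (w p : EuclideanSpace ℝ (Fin N) → ℝ) (s : ℝ) : ℝ :=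
  ∫ θ : Metric.sphere (0 : EuclideanSpace ℝ (Fin N)) 1,
    fderiv ℝ (fderiv ℝ w) (s • (θ : EuclideanSpace ℝ (Fin N))) θ θ * p θ ∂sphereVol N

theorem integral_lincomb {X : Type*} [MeasurableSpace X] {ν : Measure X} {f g h : X → ℝ}
    {a b c : ℝ} (hf : Integrable f ν) (hg : Integrable g ν) (hh : Integrable h ν) :
    ∫ x, (a * f x - b * g x - c * h x) ∂ν = a * ∫ x, f x ∂ν - b * ∫ x, g x ∂ν - c * ∫ x, h x ∂ν := by
  have h₁ : Integrable (fun x => a * f x - b * g x) ν := (hf.const_mul a).sub (hg.const_mul b)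
  rw [integral_sub h₁ (hh.const_mul c), integral_sub (hf.const_mul a) (hg.const_mul b)]
  simp only [integral_const_mul]

variable {w p : EuclideanSpace ℝ (Fin N) → ℝ}

theorem smul_sphere_ne_zero {s : ℝ} (hs : 0 < s)
    (θ : Metric.sphere (0 : EuclideanSpace ℝ (Fin N)) 1) :
    s • (θ : EuclideanSpace ℝ (Fin N)) ≠ 0 :=
  smul_ne_zero hs.ne' (ne_zero_of_mem_unit_sphere θ)

theorem continuousOn_polar {F : Type*} [TopologicalSpace F] {g : EuclideanSpace ℝ (Fin N) → F}
    (hg : ContinuousOn g {x | x ≠ 0}) :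
    ContinuousOn (fun q : ℝ × Metric.sphere (0 : EuclideanSpace ℝ (Fin N)) 1 =>
      g (q.1 • (q.2 : EuclideanSpace ℝ (Fin N)))) (Ioi 0 ×ˢ univ) :=
  hg.comp (by fun_prop) fun q hq => smul_sphere_ne_zero hq.1 q.2

theorem continuous_polar {F : Type*} [TopologicalSpace F] {g : EuclideanSpace ℝ (Fin N) → F}
    (hg : ContinuousOn g {x | x ≠ 0}) {s : ℝ} (hs : 0 < s) :
    Continuous (fun θ : Metric.sphere (0 : EuclideanSpace ℝ (Fin N)) 1 =>
      g (s • (θ : EuclideanSpace ℝ (Fin N)))) :=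
  hg.comp_continuous (by fun_prop) fun θ => smul_sphere_ne_zero hs θ

theorem hasDerivAt_polar {F : Type*} [NormedAddCommGroup F] [NormedSpace ℝ F]
    {g : EuclideanSpace ℝ (Fin N) → F} (hg : ContDiffOn ℝ 1 g {x | x ≠ 0}) {s : ℝ} (hs : 0 < s)
    (θ : Metric.sphere (0 : EuclideanSpace ℝ (Fin N)) 1) :
    HasDerivAt (fun r : ℝ => g (r • (θ : EuclideanSpace ℝ (Fin N))))
      (fderiv ℝ g (s • (θ : EuclideanSpace ℝ (Fin N))) θ) s := by
  refine (hg.hasFDerivAt_of_ne (smul_sphere_ne_zero hs θ)).comp_hasDerivAt s ?_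
  simpa using (hasDerivAt_id s).smul_const (θ : EuclideanSpace ℝ (Fin N))

theorem continuous_sphere_coe {X : Type*} [TopologicalSpace X] :
    Continuous fun q : X × Metric.sphere (0 : EuclideanSpace ℝ (Fin N)) 1 =>
      (q.2 : EuclideanSpace ℝ (Fin N)) := by fun_prop

theorem hasDerivAt_sphMoment (hw : ContDiffOn ℝ 1 w {x | x ≠ 0}) (hp : Continuous p) {s : ℝ}
    (hs : 0 < s) : HasDerivAt (sphMoment w p) (sphMoment₁ w p s) s := by
  refine hasDerivAt_integral_of_compactSpace isOpen_Ioi (s := s)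
    (f := fun r (θ : Metric.sphere (0 : EuclideanSpace ℝ (Fin N)) 1) =>
      w (r • (θ : EuclideanSpace ℝ (Fin N))) * p θ)
    (f' := fun r (θ : Metric.sphere (0 : EuclideanSpace ℝ (Fin N)) 1) =>
      fderiv ℝ w (r • (θ : EuclideanSpace ℝ (Fin N))) θ * p θ) (fun r hr => ?_) ?_ ?_ hs
  · exact (continuous_polar hw.continuousOn hr).mul (by fun_prop)
  · exact ((continuousOn_polar (hw.continuousOn_fderiv_of_isOpen isOpen_ne le_rfl)).clm_apply
      continuous_sphere_coe.continuousOn).mul (hp.comp continuous_sphere_coe).continuousOn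
  · exact fun r hr θ => (hasDerivAt_polar hw hr θ).mul_const _

theorem hasDerivAt_sphMoment₁ (hw : ContDiffOn ℝ 2 w {x | x ≠ 0}) (hp : Continuous p) {s : ℝ}
    (hs : 0 < s) : HasDerivAt (sphMoment₁ w p) (sphMoment₂ w p s) s := by
  have hw' := hw.fderiv_of_ne
  refine hasDerivAt_integral_of_compactSpace isOpen_Ioi (s := s)
    (f := fun r (θ : Metric.sphere (0 : EuclideanSpace ℝ (Fin N)) 1) =>
      fderiv ℝ w (r • (θ : EuclideanSpace ℝ (Fin N))) θ * p θ)
    (f' := fun r (θ : Metric.sphere (0 : EuclideanSpace ℝ (Fin N)) 1) =>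
      fderiv ℝ (fderiv ℝ w) (r • (θ : EuclideanSpace ℝ (Fin N))) θ θ * p θ) (fun r hr => ?_) ?_ ?_ hs
  · exact ((continuous_polar hw'.continuousOn hr).clm_apply continuous_subtype_val).mul
      (by fun_prop)
  · exact (((continuousOn_polar (hw'.continuousOn_fderiv_of_isOpen isOpen_ne le_rfl)).clm_apply
      continuous_sphere_coe.continuousOn).clm_apply continuous_sphere_coe.continuousOn).mul
      (hp.comp continuous_sphere_coe).continuousOn
  · intro r hr θ
    have h := (hasDerivAt_polar hw' hr θ).clm_apply (hasDerivAt_const r (θ : EuclideanSpace ℝ (Fin N)))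
    simpa using h.mul_const (p θ)

theorem continuousOn_sphMoment₂ (hw : ContDiffOn ℝ 2 w {x | x ≠ 0}) (hp : Continuous p) :
    ContinuousOn (sphMoment₂ w p) (Ioi 0) := by
  refine continuousOn_integral_of_compactSpace
    (f := fun r (θ : Metric.sphere (0 : EuclideanSpace ℝ (Fin N)) 1) =>
      fderiv ℝ (fderiv ℝ w) (r • (θ : EuclideanSpace ℝ (Fin N))) θ θ * p θ) ?_
  exact (((continuousOn_polar
      (hw.fderiv_of_ne.continuousOn_fderiv_of_isOpen isOpen_ne le_rfl)).clm_apply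
      continuous_sphere_coe.continuousOn).clm_apply continuous_sphere_coe.continuousOn).mul
      (hp.comp continuous_sphere_coe).continuousOn

theorem contDiffOn_comp_smul (hw : ContDiffOn ℝ 2 w {x | x ≠ 0}) {s : ℝ} (hs : 0 < s) :
    ContDiffOn ℝ 2 (fun x => w (s • x)) {x | x ≠ 0} :=
  hw.comp (contDiff_const_smul s).contDiffOn fun _ hx => smul_ne_zero hs.ne' hx

theorem angLap_comp_smul (hw : ContDiffOn ℝ 2 w {x | x ≠ 0}) {s : ℝ} (hs : 0 < s)
    (θ : Metric.sphere (0 : EuclideanSpace ℝ (Fin N)) 1) :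
    angLap (fun x => w (s • x)) θ = s ^ 2 * lap w (s • (θ : EuclideanSpace ℝ (Fin N))) -
      s ^ 2 * fderiv ℝ (fderiv ℝ w) (s • (θ : EuclideanSpace ℝ (Fin N))) θ θ -
      (N - 1) * (s * fderiv ℝ w (s • (θ : EuclideanSpace ℝ (Fin N))) θ) := by
  have hθ : (θ : EuclideanSpace ℝ (Fin N)) ≠ 0 := ne_zero_of_mem_unit_sphere θ
  have hsθ := smul_sphere_ne_zero hs θ
  have h₁ : fderiv ℝ (fun x => w (s • x)) = fun x => s • fderiv ℝ w (s • x) := by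
    funext x
    exact fderiv_comp_smul s
  have h₂ : fderiv ℝ (fderiv ℝ (fun x => w (s • x))) θ =
      s • s • fderiv ℝ (fderiv ℝ w) (s • (θ : EuclideanSpace ℝ (Fin N))) := by
    have h := ((hw.fderiv_of_ne.hasFDerivAt_of_ne hsθ).comp (θ : EuclideanSpace ℝ (Fin N))
      ((hasFDerivAt_id (𝕜 := ℝ) _).const_smul s)).const_smul s
    rw [h₁]
    refine (HasFDerivAt.fderiv h).trans ?_
    ext
    simp
  rw [angLap, lap_eq_sum (contDiffOn_comp_smul hw hs) hθ, lap_eq_sum hw hsθ, h₂, h₁,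
    norm_eq_of_mem_sphere θ]
  simp only [smul_apply, smul_eq_mul, ← Finset.mul_sum]
  ring

theorem sphMoment_ode (hw : ContDiffOn ℝ 2 w {x | x ≠ 0}) (hp : ContDiff ℝ 2 p) {α : ℝ}
    {a : EuclideanSpace ℝ (Fin N) → ℝ} {A : ℝ → ℝ}
    (hlap : ∀ x, x ≠ 0 → -(lap w x) = ‖x‖ ^ α * a x * w x) (ha : ∀ x, x ≠ 0 → a x = A ‖x‖)
    {s : ℝ} (hs : 0 < s) :
    s ^ 2 * sphMoment₂ w p s + (N - 1) * (s * sphMoment₁ w p s) +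
      s ^ 2 * (s ^ α * A s) * sphMoment w p s = - sphMoment w (angLap p) s := by
  have key := integral_angLap_mul (contDiffOn_comp_smul hw hs) hp.contDiffOn
  have hl : ∀ θ : Metric.sphere (0 : EuclideanSpace ℝ (Fin N)) 1,
      lap w (s • (θ : EuclideanSpace ℝ (Fin N))) =
        -(s ^ α * A s * w (s • (θ : EuclideanSpace ℝ (Fin N)))) := fun θ => by
    have h := hlap _ (smul_sphere_ne_zero hs θ)
    rw [ha _ (smul_sphere_ne_zero hs θ), norm_smul, norm_eq_of_mem_sphere, mul_one,
      Real.norm_of_nonneg hs.le] at h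
    linarith
  have hpc := hp.continuous
  have hw' := hw.fderiv_of_ne
  have hi₀ : Integrable (fun θ : Metric.sphere (0 : EuclideanSpace ℝ (Fin N)) 1 =>
      w (s • (θ : EuclideanSpace ℝ (Fin N))) * p θ) (sphereVol N) :=
    ((continuous_polar hw.continuousOn hs).mul (by fun_prop)).integrable_of_compactSpace
  have hi₁ : Integrable (fun θ : Metric.sphere (0 : EuclideanSpace ℝ (Fin N)) 1 =>
      fderiv ℝ w (s • (θ : EuclideanSpace ℝ (Fin N))) θ * p θ) (sphereVol N) :=
    (((continuous_polar hw'.continuousOn hs).clm_apply continuous_subtype_val).mul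
      (by fun_prop)).integrable_of_compactSpace
  have hi₂ : Integrable (fun θ : Metric.sphere (0 : EuclideanSpace ℝ (Fin N)) 1 =>
      fderiv ℝ (fderiv ℝ w) (s • (θ : EuclideanSpace ℝ (Fin N))) θ θ * p θ) (sphereVol N) :=
    ((((continuous_polar (hw'.continuousOn_fderiv_of_isOpen isOpen_ne le_rfl) hs).clm_apply
      continuous_subtype_val).clm_apply continuous_subtype_val).mul
      (by fun_prop)).integrable_of_compactSpace
  have e : ∀ θ : Metric.sphere (0 : EuclideanSpace ℝ (Fin N)) 1,
      angLap (fun x => w (s • x)) θ * p θ =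
        (-(s ^ 2 * (s ^ α * A s))) * (w (s • (θ : EuclideanSpace ℝ (Fin N))) * p θ) -
        s ^ 2 * (fderiv ℝ (fderiv ℝ w) (s • (θ : EuclideanSpace ℝ (Fin N))) θ θ * p θ) -
        ((N - 1) * s) * (fderiv ℝ w (s • (θ : EuclideanSpace ℝ (Fin N))) θ * p θ) := fun θ => by
    rw [angLap_comp_smul hw hs, hl θ]
    ring
  simp only [e] at key
  rw [integral_lincomb hi₀ hi₂ hi₁] at key
  simp only [sphMoment, sphMoment₁, sphMoment₂]
  linear_combination -key

end SphereMean

section PolarIntegrability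

variable {N : ℕ}

theorem integrableOn_polar {f : EuclideanSpace ℝ (Fin N) → ℝ} (hf : Integrable f) :
    IntegrableOn (fun s : ℝ => s ^ (N - 1) *
      ∫ θ : Metric.sphere (0 : EuclideanSpace ℝ (Fin N)) 1,
        f (s • (θ : EuclideanSpace ℝ (Fin N))) ∂sphereVol N) (Ioi 0) := by
  have h := (volume : Measure (EuclideanSpace ℝ (Fin N))).measurePreserving_homeomorphUnitSphereProd
    |>.integrable_comp_emb (g := fun q => f ((q.2 : ℝ) • (q.1 : EuclideanSpace ℝ (Fin N))))
    (Homeomorph.measurableEmbedding _)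
  have hf' : Integrable (fun x : ({0}ᶜ : Set (EuclideanSpace ℝ (Fin N))) => f x)
      (Measure.comap Subtype.val volume) :=
    (integrableOn_iff_comap_subtypeVal (measurableSet_singleton _).compl).1 hf.integrableOn
  have h₁ := (h.1 (by
    convert! hf' using 1
    funext x
    have hx : ‖(x : EuclideanSpace ℝ (Fin N))‖ ≠ 0 := norm_ne_zero_iff.2 x.2
    simp [smul_smul, hx])).integral_prod_right
  rw [integrableOn_iff_comap_subtypeVal measurableSet_Ioi]
  rw [Measure.volumeIoiPow, integrable_withDensity_iff_integrable_smul' (by fun_prop) (by simp)]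
    at h₁
  refine h₁.congr (ae_of_all _ fun s => ?_)
  have hs : (0 : ℝ) ≤ (s : ℝ) := (mem_Ioi.1 s.2).le
  simp [ENNReal.toReal_ofReal (pow_nonneg hs _)]

theorem sq_integral_mul_le_of_bound {g h p : Metric.sphere (0 : EuclideanSpace ℝ (Fin N)) 1 → ℝ} {C : ℝ}
    (hg : Continuous g) (hh : Continuous h) (hp : Continuous p) (hgh : ∀ θ, |g θ| ≤ h θ)
    (hC : ∀ θ, |p θ| ≤ C) :
    (∫ θ, g θ * p θ ∂sphereVol N) ^ 2 ≤
      (sphereVol N).real univ * C ^ 2 * ∫ θ, h θ ^ 2 ∂sphereVol N := by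
  set M := (sphereVol N).real univ
  have hM : 0 ≤ M := measureReal_nonneg
  set I := ∫ θ, g θ * p θ ∂sphereVol N
  have hgp : Integrable (fun θ => g θ * p θ) (sphereVol N) :=
    (hg.mul hp).integrable_of_compactSpace
  have hgp2 : Integrable (fun θ => (g θ * p θ) ^ 2) (sphereVol N) :=
    ((hg.mul hp).pow 2).integrable_of_compactSpace
  have h2 : Integrable (fun θ => h θ ^ 2) (sphereVol N) := (hh.pow 2).integrable_of_compactSpace
  have key : 0 ≤ ∫ θ, (M * (g θ * p θ) - I) ^ 2 ∂sphereVol N := integral_nonneg fun θ => sq_nonneg _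
  have e : ∀ θ, (M * (g θ * p θ) - I) ^ 2 =
      M ^ 2 * (g θ * p θ) ^ 2 - 2 * M * I * (g θ * p θ) - (-I ^ 2) * 1 := fun θ => by ring
  simp only [e] at key
  rw [integral_lincomb hgp2 hgp (integrable_const _)] at key
  simp only [integral_const, smul_eq_mul, mul_one] at key
  change 0 ≤ M ^ 2 * _ - 2 * M * I * I - -I ^ 2 * M at key
  have hle : ∫ θ, (g θ * p θ) ^ 2 ∂sphereVol N ≤ C ^ 2 * ∫ θ, h θ ^ 2 ∂sphereVol N := by
    rw [← integral_const_mul]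
    refine integral_mono hgp2 (h2.const_mul _) fun θ => ?_
    simp only
    rw [mul_pow, mul_comm, ← sq_abs (p θ), ← sq_abs (g θ)]
    have := hgh θ
    have := hC θ
    gcongr
  rcases hM.eq_or_lt with h0 | hpos
  · have : sphereVol N = 0 := by
      rw [← Measure.measure_univ_eq_zero]
      exact (measureReal_eq_zero_iff).1 h0.symm
    simp [I, this]
  · have : 0 ≤ M * (∫ θ, (g θ * p θ) ^ 2 ∂sphereVol N) - I ^ 2 := by
      by_contra hneg
      push Not at hneg
      nlinarith [mul_neg_of_pos_of_neg hpos hneg]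
    nlinarith

variable {w p : EuclideanSpace ℝ (Fin N) → ℝ}

theorem exists_sphere_bound (hp : Continuous p) :
    ∃ C, ∀ θ : Metric.sphere (0 : EuclideanSpace ℝ (Fin N)) 1, |p θ| ≤ C := by
  obtain ⟨C, hC⟩ := (isCompact_sphere (0 : EuclideanSpace ℝ (Fin N)) 1).exists_bound_of_continuousOn
    hp.continuousOn
  exact ⟨C, fun θ => hC θ θ.2⟩

theorem integrableOn_sphMoment_sq {α : ℝ} (hw : ContDiffOn ℝ 2 w {x | x ≠ 0}) (hp : Continuous p)
    (hi : Integrable fun x : EuclideanSpace ℝ (Fin N) => ‖x‖ ^ α * w x ^ 2) :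
    IntegrableOn (fun s : ℝ => s ^ (N - 1) * s ^ α * sphMoment w p s ^ 2) (Ioi 0) := by
  obtain ⟨C, hC⟩ := exists_sphere_bound hp
  refine integrableOn_Ioi_of_abs_le (g := fun s => (sphereVol N).real univ * C ^ 2 * _)
    ?_ ((integrableOn_polar hi).const_mul _) fun s hs => ?_
  · exact ((continuousOn_pow _).mul (continuousOn_rpow_Ioi α)).mul
      (ContinuousOn.pow (fun s hs => (hasDerivAt_sphMoment (hw.of_le one_le_two) hp
        hs).continuousAt.continuousWithinAt) 2)
  · have hc := continuous_polar hw.continuousOn hs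
    have h := sq_integral_mul_le_of_bound hc hc.abs (hp.comp continuous_subtype_val)
      (fun θ => le_rfl) hC
    have hs' : 0 ≤ s ^ (N - 1) * s ^ α := by positivity
    rw [abs_of_nonneg (by positivity)]
    simp only [norm_smul, norm_eq_of_mem_sphere, mul_one, Real.norm_of_nonneg hs.le,
      integral_const_mul, sq_abs] at h ⊢
    calc _ ≤ s ^ (N - 1) * s ^ α * _ := mul_le_mul_of_nonneg_left h hs'
      _ = _ := by ring

theorem integrableOn_sphMoment₁_sq (hw : ContDiffOn ℝ 2 w {x | x ≠ 0}) (hp : Continuous p)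
    (hi : Integrable fun x : EuclideanSpace ℝ (Fin N) => ‖fderiv ℝ w x‖ ^ 2) :
    IntegrableOn (fun s : ℝ => s ^ (N - 1) * sphMoment₁ w p s ^ 2) (Ioi 0) := by
  obtain ⟨C, hC⟩ := exists_sphere_bound hp
  refine integrableOn_Ioi_of_abs_le (g := fun s => (sphereVol N).real univ * C ^ 2 * _)
    ?_ ((integrableOn_polar hi).const_mul _) fun s hs => ?_
  · exact (continuousOn_pow _).mul
      (ContinuousOn.pow (fun s hs => (hasDerivAt_sphMoment₁ hw hp
        hs).continuousAt.continuousWithinAt) 2)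
  · have hc := continuous_polar hw.fderiv_of_ne.continuousOn hs
    have h := sq_integral_mul_le_of_bound (hc.clm_apply continuous_subtype_val) hc.norm
      (hp.comp continuous_subtype_val) (fun θ => by
        simpa [norm_eq_of_mem_sphere] using (fderiv ℝ w (s • (θ : EuclideanSpace ℝ (Fin N)))).le_opNorm θ)
      hC
    have hs' : 0 ≤ s ^ (N - 1) := by positivity
    rw [abs_of_nonneg (by positivity)]
    calc _ ≤ s ^ (N - 1) * _ := mul_le_mul_of_nonneg_left h hs'
      _ = _ := by ring

end PolarIntegrability

section Density

open scoped RealInnerProductSpace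

variable {N : ℕ}

theorem integral_mul_exp_eq_zero {f : Metric.sphere (0 : EuclideanSpace ℝ (Fin N)) 1 → ℝ}
    (hf : Continuous f) (v : EuclideanSpace ℝ (Fin N))
    (h : ∀ d : ℕ, ∫ θ, f θ * ⟪v, (θ : EuclideanSpace ℝ (Fin N))⟫ ^ d ∂sphereVol N = 0) :
    ∫ θ, f θ * Real.exp ⟪v, (θ : EuclideanSpace ℝ (Fin N))⟫ ∂sphereVol N = 0 := by
  obtain ⟨C, hC⟩ := isCompact_univ.exists_bound_of_continuousOn hf.continuousOn
  have hsum := hasSum_integral_of_dominated_convergence (μ := sphereVol N)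
    (F := fun (d : ℕ) θ => f θ * ((d.factorial : ℝ)⁻¹ *
      ⟪v, (θ : EuclideanSpace ℝ (Fin N))⟫ ^ d))
    (f := fun θ => f θ * Real.exp ⟪v, (θ : EuclideanSpace ℝ (Fin N))⟫)
    (fun d _ => C * ((d.factorial : ℝ)⁻¹ * ‖v‖ ^ d))
    (fun d => Continuous.aestronglyMeasurable (by fun_prop))
    (fun d => ae_of_all _ fun θ => ?_)
    (ae_of_all _ fun θ => ?_) (integrable_const _) (ae_of_all _ fun θ => ?_)
  · have h0 : (fun d : ℕ => ∫ θ, f θ * ((d.factorial : ℝ)⁻¹ *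
        ⟪v, (θ : EuclideanSpace ℝ (Fin N))⟫ ^ d) ∂sphereVol N) = fun _ => 0 := by
      funext d
      simp only [mul_left_comm (f _), integral_const_mul, h d, mul_zero]
    rw [h0] at hsum
    exact hsum.unique hasSum_zero
  · rw [norm_mul, norm_mul, norm_pow, Real.norm_of_nonneg (by positivity : (0 : ℝ) ≤ _⁻¹)]
    have h1 : ‖⟪v, (θ : EuclideanSpace ℝ (Fin N))⟫‖ ≤ ‖v‖ := by
      simpa [norm_eq_of_mem_sphere] using norm_inner_le_norm (𝕜 := ℝ) v
        (θ : EuclideanSpace ℝ (Fin N))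
    have h2 := hC θ (mem_univ _)
    have h3 : 0 ≤ C := (norm_nonneg _).trans h2
    gcongr
  · simpa [div_eq_inv_mul] using (Real.summable_pow_div_factorial ‖v‖).mul_left C
  · have := (NormedSpace.expSeries_div_hasSum_exp ⟪v, (θ : EuclideanSpace ℝ (Fin N))⟫).mul_left
      (f θ)
    simpa [div_eq_inv_mul, Real.exp_eq_exp_ℝ] using this

/-- The exponential `θ ↦ exp ⟪v, θ⟫` on the unit sphere, as a monoid homomorphism in `v`. -/
noncomputable def sphereExp (N : ℕ) : Multiplicative (EuclideanSpace ℝ (Fin N)) →*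
    C(Metric.sphere (0 : EuclideanSpace ℝ (Fin N)) 1, ℝ) where
  toFun v := ⟨fun θ => Real.exp ⟪v.toAdd, (θ : EuclideanSpace ℝ (Fin N))⟫, by fun_prop⟩
  map_one' := by ext; simp
  map_mul' v w := by ext; simp [inner_add_left, Real.exp_add]

theorem eq_zero_of_integral_mul_pow {f : Metric.sphere (0 : EuclideanSpace ℝ (Fin N)) 1 → ℝ}
    (hf : Continuous f)
    (h : ∀ (v : EuclideanSpace ℝ (Fin N)) (d : ℕ),
      ∫ θ, f θ * ⟪v, (θ : EuclideanSpace ℝ (Fin N))⟫ ^ d ∂sphereVol N = 0) : f = 0 := by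
  set A := Algebra.adjoin ℝ ((MonoidHom.mrange (sphereExp N) : Submonoid _) :
    Set C(Metric.sphere (0 : EuclideanSpace ℝ (Fin N)) 1, ℝ)) with hA
  have hA0 : ∀ g ∈ A, ∫ θ, f θ * g θ ∂sphereVol N = 0 := by
    intro g hg
    rw [← Subalgebra.mem_toSubmodule, hA, Algebra.adjoin_eq_span, Submonoid.closure_eq] at hg
    induction hg using Submodule.span_induction with
    | mem x hx =>
      obtain ⟨v, rfl⟩ := hx
      exact integral_mul_exp_eq_zero hf _ (h _)
    | zero => simp
    | add x y _ _ hx hy =>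
      have hix : ∀ x : C(Metric.sphere (0 : EuclideanSpace ℝ (Fin N)) 1, ℝ),
          Integrable (fun θ => f θ * x θ) (sphereVol N) := fun x =>
        (hf.mul x.continuous).integrable_of_compactSpace
      simp only [ContinuousMap.add_apply, mul_add]
      rw [integral_add (hix x) (hix y), hx, hy, add_zero]
    | smul a x _ hx =>
      simp only [ContinuousMap.smul_apply, smul_eq_mul, mul_left_comm _ a, integral_const_mul, hx,
        mul_zero]
  have hsep : A.SeparatesPoints := by
    intro x y hxy
    by_contra hcon
    push Not at hcon
    refine hxy (Subtype.ext (ext_inner_left ℝ fun v => ?_))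
    have := hcon _ ⟨sphereExp N (Multiplicative.ofAdd v), Algebra.subset_adjoin ⟨_, rfl⟩, rfl⟩
    exact Real.exp_injective this
  have hle : ∀ ε > 0, ∫ θ, f θ ^ 2 ∂sphereVol N ≤ ε * ∫ θ, |f θ| ∂sphereVol N := by
    intro ε hε
    obtain ⟨g, hg⟩ := ContinuousMap.exists_mem_subalgebra_near_continuous_of_separatesPoints A hsep
      f hf ε hε
    have hgc : Continuous (g : C(Metric.sphere (0 : EuclideanSpace ℝ (Fin N)) 1, ℝ)) :=
      (g : C(Metric.sphere (0 : EuclideanSpace ℝ (Fin N)) 1, ℝ)).continuous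
    have hi2 : Integrable (fun θ => f θ ^ 2) (sphereVol N) :=
      (hf.pow 2).integrable_of_compactSpace
    have hig : Integrable (fun θ => f θ * (g : C(_, ℝ)) θ) (sphereVol N) :=
      (hf.mul hgc).integrable_of_compactSpace
    calc ∫ θ, f θ ^ 2 ∂sphereVol N
        = ∫ θ, (f θ ^ 2 - f θ * (g : C(_, ℝ)) θ) ∂sphereVol N := by
          rw [integral_sub hi2 hig, hA0 g g.2, sub_zero]
      _ ≤ ∫ θ, ε * |f θ| ∂sphereVol N := by
          refine integral_mono (hi2.sub hig) (hf.abs.integrable_of_compactSpace.const_mul ε)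
            fun θ => ?_
          have := (hg θ).le
          rw [Real.norm_eq_abs, abs_sub_comm] at this
          calc f θ ^ 2 - f θ * (g : C(_, ℝ)) θ = f θ * (f θ - (g : C(_, ℝ)) θ) := by ring
            _ ≤ |f θ| * |f θ - (g : C(_, ℝ)) θ| := by rw [← abs_mul]; exact le_abs_self _
            _ ≤ |f θ| * ε := by gcongr
            _ = ε * |f θ| := mul_comm _ _
      _ = _ := integral_const_mul _ _
  have hzero : ∫ θ, f θ ^ 2 ∂sphereVol N = 0 := by
    refine le_antisymm ?_ (integral_nonneg fun θ => sq_nonneg _)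
    have hI : 0 ≤ ∫ θ, |f θ| ∂sphereVol N := integral_nonneg fun θ => abs_nonneg _
    refine le_of_forall_pos_le_add fun δ hδ => ?_
    refine (hle (δ / (∫ θ, |f θ| ∂sphereVol N + 1)) (by positivity)).trans ?_
    rw [zero_add, div_mul_eq_mul_div, div_le_iff₀ (by positivity)]
    nlinarith
  have hae := (integral_eq_zero_iff_of_nonneg (fun θ => sq_nonneg (f θ))
    (hf.pow 2).integrable_of_compactSpace).1 hzero
  have := (Continuous.ae_eq_iff_eq (sphereVol N) (hf.pow 2)
    (continuous_const (y := (0 : ℝ)))).1 hae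
  funext θ
  exact (pow_eq_zero_iff two_ne_zero).1 (congrFun this θ)

end Density

section RadialVariable

/-- The change of variables `s ↦ 2/(2+α) * s^((2+α)/2)`. -/
noncomputable def radVar (α s : ℝ) : ℝ := 2 / (2 + α) * s ^ ((2 + α) / 2)

/-- The inverse of `radVar α` on `(0, ∞)`. -/
noncomputable def radInv (α t : ℝ) : ℝ := ((2 + α) / 2 * t) ^ (2 / (2 + α))

variable {α : ℝ}

theorem radVar_pos (hα : 0 < α) {s : ℝ} (hs : 0 < s) : 0 < radVar α s := by
  unfold radVar; positivity

theorem radInv_pos (hα : 0 < α) {t : ℝ} (ht : 0 < t) : 0 < radInv α t := by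
  unfold radInv; positivity

theorem radVar_radInv (hα : 0 < α) {t : ℝ} (ht : 0 < t) : radVar α (radInv α t) = t := by
  have h2 : (2 + α) ≠ 0 := by positivity
  rw [radVar, radInv, ← Real.rpow_mul (by positivity)]
  rw [show 2 / (2 + α) * ((2 + α) / 2) = 1 by field_simp, Real.rpow_one]
  field_simp

theorem radInv_radVar (hα : 0 < α) {s : ℝ} (hs : 0 < s) : radInv α (radVar α s) = s := by
  have h2 : (2 + α) ≠ 0 := by positivity
  rw [radVar, radInv, ← mul_assoc, show (2 + α) / 2 * (2 / (2 + α)) = 1 by field_simp, one_mul,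
    ← Real.rpow_mul hs.le, show (2 + α) / 2 * (2 / (2 + α)) = 1 by field_simp, Real.rpow_one]

theorem hasDerivAt_radVar (hα : 0 < α) {s : ℝ} (hs : 0 < s) :
    HasDerivAt (radVar α) (s ^ (α / 2)) s := by
  have h2 : (2 + α) ≠ 0 := by positivity
  have h := (Real.hasDerivAt_rpow_const (p := (2 + α) / 2) (Or.inl hs.ne')).const_mul (2 / (2 + α))
  convert! h using 1
  rw [show (2 + α) / 2 - 1 = α / 2 by ring]
  field_simp

theorem hasDerivAt_radInv (hα : 0 < α) {t : ℝ} (ht : 0 < t) :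
    HasDerivAt (radInv α) (radInv α t ^ (-(α / 2))) t := by
  have h2 : (2 + α) ≠ 0 := by positivity
  have h := ((hasDerivAt_id t).const_mul ((2 + α) / 2)).rpow_const (p := 2 / (2 + α))
    (Or.inl (by simp only [id]; positivity))
  convert! h using 1
  rw [radInv, ← Real.rpow_mul (by positivity),
    show 2 / (2 + α) * -(α / 2) = 2 / (2 + α) - 1 by field_simp; ring]
  simp only [id]
  field_simp

theorem image_radVar (hα : 0 < α) : radVar α '' Ioi 0 = Ioi 0 := by
  ext t
  constructor
  · rintro ⟨s, hs, rfl⟩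
    exact radVar_pos hα hs
  · exact fun ht => ⟨radInv α t, radInv_pos hα ht, radVar_radInv hα ht⟩

theorem integrableOn_comp_radVar (hα : 0 < α) (f : ℝ → ℝ) :
    IntegrableOn f (Ioi 0) ↔ IntegrableOn (fun s => s ^ (α / 2) * f (radVar α s)) (Ioi 0) := by
  have hinj : InjOn (radVar α) (Ioi 0) := fun a ha b hb hab => by
    rw [← radInv_radVar hα ha, hab, radInv_radVar hα hb]
  have h := integrableOn_image_iff_integrableOn_abs_deriv_smul measurableSet_Ioi
    (fun s hs => (hasDerivAt_radVar hα hs).hasDerivWithinAt) hinj f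
  rw [image_radVar hα] at h
  rw [h]
  refine integrableOn_congr_fun (fun s hs => ?_) measurableSet_Ioi
  simp only [smul_eq_mul]
  rw [abs_of_nonneg (Real.rpow_nonneg (le_of_lt hs) _)]

theorem rpow_half_sq {s : ℝ} (hs : 0 < s) (a : ℝ) : s ^ (a / 2) * s ^ (a / 2) = s ^ a := by
  rw [← Real.rpow_add hs]; ring_nf

theorem radVar_rpow_mul (hα : 0 < α) (N : ℕ) {s : ℝ} (hs : 0 < s) (a b : ℝ) :
    s ^ (α / 2) * (radVar α s ^ kk N α * (a ^ 2 + b ^ 2)) =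
      (2 / (2 + α)) ^ kk N α * (s ^ ((N : ℝ) - 1) * (s ^ (α / 2) * a) ^ 2 +
        s ^ ((N : ℝ) - 1) * s ^ α * b ^ 2) := by
  have h2 : (2 + α) ≠ 0 := by positivity
  rw [radVar, Real.mul_rpow (by positivity) (by positivity), ← Real.rpow_mul hs.le,
    show (2 + α) / 2 * kk N α = ((N : ℝ) - 1) + α / 2 by rw [kk]; field_simp,
    Real.rpow_add hs, show s ^ α = s ^ (α / 2) * s ^ (α / 2) from (rpow_half_sq hs α).symm]
  ring

theorem ContDiffOn.two_of_hasDerivAt {f f₁ f₂ : ℝ → ℝ} (h₁ : ∀ t > (0 : ℝ), HasDerivAt f (f₁ t) t)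
    (h₂ : ∀ t > (0 : ℝ), HasDerivAt f₁ (f₂ t) t) (hc : ContinuousOn f₂ (Ioi 0)) :
    ContDiffOn ℝ 2 f (Ioi 0) := by
  have hs : ∀ (g g' : ℝ → ℝ) (n : ℕ), (∀ t > (0 : ℝ), HasDerivAt g (g' t) t) →
      ContDiffOn ℝ n g' (Ioi 0) → ContDiffOn ℝ (n + 1 : ℕ) g (Ioi 0) := by
    intro g g' n hg hg'
    have := (contDiffOn_succ_iff_deriv_of_isOpen (n := (n : WithTop ℕ∞)) (f := g)
      (isOpen_Ioi (a := (0 : ℝ)))).2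
      ⟨fun t ht => (hg t ht).differentiableAt.differentiableWithinAt, by simp,
        hg'.congr fun t ht => (hg t ht).deriv⟩
    exact_mod_cast this
  exact_mod_cast hs f f₁ 1 h₁ (hs f₁ f₂ 0 h₂ (by exact_mod_cast contDiffOn_zero.2 hc))

theorem memE_of_radial (hα : 0 < α) (N : ℕ) {Z Z₁ ψ : ℝ → ℝ}
    (hψ : ContDiffOn ℝ 1 ψ (Ioi 0))
    (hZ : ∀ s > (0 : ℝ), Z s = ψ (radVar α s))
    (hZ₁ : ∀ s > (0 : ℝ), Z₁ s = s ^ (α / 2) * deriv ψ (radVar α s))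
    (hi : IntegrableOn (fun s => s ^ ((N : ℝ) - 1) * s ^ α * Z s ^ 2) (Ioi 0))
    (hi₁ : IntegrableOn (fun s => s ^ ((N : ℝ) - 1) * Z₁ s ^ 2) (Ioi 0)) :
    memE (kk N α) ψ := by
  refine ⟨hψ, (integrableOn_comp_radVar hα _).2 ?_⟩
  refine IntegrableOn.congr_fun ((hi₁.add hi).const_mul ((2 / (2 + α)) ^ kk N α)) (fun s hs => ?_)
    measurableSet_Ioi
  simp only [Pi.add_apply]
  rw [radVar_rpow_mul hα N hs, hZ s hs, hZ₁ s hs]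

/-- A radial profile solving the separated equation yields a solution of the transformed one. -/
theorem radial_transfer (hα : 0 < α) (N : ℕ) {Z Z₁ Z₂ A : ℝ → ℝ} {l : ℝ}
    (h₁ : ∀ s > (0 : ℝ), HasDerivAt Z (Z₁ s) s) (h₂ : ∀ s > (0 : ℝ), HasDerivAt Z₁ (Z₂ s) s)
    (hc : ContinuousOn Z₂ (Ioi 0))
    (hode : ∀ s > (0 : ℝ), s ^ 2 * Z₂ s + (N - 1) * (s * Z₁ s) +
      s ^ 2 * (s ^ α * A (radVar α s)) * Z s = l * Z s)
    (hi : IntegrableOn (fun s => s ^ ((N : ℝ) - 1) * s ^ α * Z s ^ 2) (Ioi 0))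
    (hi₁ : IntegrableOn (fun s => s ^ ((N : ℝ) - 1) * Z₁ s ^ 2) (Ioi 0)) :
    ContDiffOn ℝ 2 (fun t => Z (radInv α t)) (Ioi 0) ∧
    SingularSol (kk N α) A (l * (2 / (2 + α)) ^ 2) (fun t => Z (radInv α t)) := by
  have h2 : (2 + α) ≠ 0 := by positivity
  set ψ : ℝ → ℝ := fun t => Z (radInv α t) with hψdef
  have d₁ : ∀ t > (0 : ℝ), HasDerivAt ψ (Z₁ (radInv α t) * radInv α t ^ (-(α / 2))) t :=
    fun t ht => HasDerivAt.comp (h₂ := Z) t (h₁ _ (radInv_pos hα ht)) (hasDerivAt_radInv hα ht)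
  have d₂ : ∀ t > (0 : ℝ), HasDerivAt (fun t => Z₁ (radInv α t) * radInv α t ^ (-(α / 2)))
      (Z₂ (radInv α t) * radInv α t ^ (-(α / 2)) * radInv α t ^ (-(α / 2)) +
        Z₁ (radInv α t) * (radInv α t ^ (-(α / 2)) * (-(α / 2)) *
          radInv α t ^ (-(α / 2) - 1))) t := fun t ht =>
    (HasDerivAt.comp (h₂ := Z₁) t (h₂ _ (radInv_pos hα ht)) (hasDerivAt_radInv hα ht)).mul
      ((hasDerivAt_radInv hα ht).rpow_const (Or.inl (radInv_pos hα ht).ne'))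
  have hcI : ContinuousOn (radInv α) (Ioi 0) := fun t ht =>
    (hasDerivAt_radInv hα ht).continuousAt.continuousWithinAt
  have hmaps : MapsTo (radInv α) (Ioi 0) (Ioi 0) := fun t ht => radInv_pos hα ht
  have hcZ₁ : ContinuousOn Z₁ (Ioi 0) := fun s hs => (h₂ s hs).continuousAt.continuousWithinAt
  have hp : ∀ p : ℝ, ContinuousOn (fun t => radInv α t ^ p) (Ioi 0) := fun p =>
    (continuousOn_rpow_Ioi p).comp hcI hmaps
  have hC2 : ContDiffOn ℝ 2 ψ (Ioi 0) := ContDiffOn.two_of_hasDerivAt d₁ d₂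
    ((((hc.comp hcI hmaps).mul (hp _)).mul (hp _)).add
      ((hcZ₁.comp hcI hmaps).mul (((hp _).mul continuousOn_const).mul (hp _))))
  have hev : ∀ t > (0 : ℝ), deriv ψ =ᶠ[𝓝 t]
      fun t => Z₁ (radInv α t) * radInv α t ^ (-(α / 2)) := fun t ht =>
    eventually_of_mem (Ioi_mem_nhds ht) fun y hy => (d₁ y hy).deriv
  have dd : ∀ t > (0 : ℝ), HasDerivAt (deriv ψ) _ t := fun t ht =>
    (d₂ t ht).congr_of_eventuallyEq (hev t ht)
  refine ⟨hC2, ?_, fun t ht => (dd t ht).differentiableAt.hasDerivAt, fun t ht => ?_⟩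
  · refine memE_of_radial hα N (Z := Z) (Z₁ := Z₁) (hC2.of_le (by norm_num)) (fun s hs => ?_)
      (fun s hs => ?_) hi hi₁
    · rw [hψdef]; simp only [radInv_radVar hα hs]
    · rw [(d₁ _ (radVar_pos hα hs)).deriv, radInv_radVar hα hs, Real.rpow_neg hs.le]
      have := (Real.rpow_pos_of_pos hs (α / 2)).ne'
      field_simp
  · rw [(dd t ht).deriv, (d₁ t ht).deriv]
    obtain ⟨s, hs, rfl⟩ : ∃ s > 0, radVar α s = t :=
      ⟨radInv α t, radInv_pos hα ht, radVar_radInv hα ht⟩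
    have ho := hode s hs
    have hq := rpow_half_sq hs α
    have hpos := Real.rpow_pos_of_pos hs (α / 2)
    have hv : radVar α s = 2 / (2 + α) * (s ^ (α / 2) * s) := by
      rw [radVar, show (2 + α) / 2 = α / 2 + 1 by ring, Real.rpow_add hs, Real.rpow_one]
    simp only [hψdef, radInv_radVar hα hs]
    rw [← hq] at ho
    rw [Real.rpow_sub hs, Real.rpow_neg hs.le, Real.rpow_one]
    generalize A (radVar α s) = a at *
    rw [hv, kk]
    generalize s ^ (α / 2) = q at *
    field_simp
    linear_combination 2 * ho

end RadialVariable

section Radiality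

open scoped RealInnerProductSpace

variable {N : ℕ} {α : ℝ} {A : ℝ → ℝ} {w : EuclideanSpace ℝ (Fin N) → ℝ}

theorem LinSolution.moment_transfer (hN : 0 < N) (hα : 0 < α)
    (hw : LinSolution N α (fun x => A (radVar α ‖x‖)) w) {p : EuclideanSpace ℝ (Fin N) → ℝ}
    (hp : ContDiff ℝ 2 p) {l : ℝ}
    (hl : ∀ s > (0 : ℝ), sphMoment w (angLap p) s = -(l * sphMoment w p s)) :
    ContDiffOn ℝ 2 (fun t => sphMoment w p (radInv α t)) (Ioi 0) ∧
    SingularSol (kk N α) A (l * (2 / (2 + α)) ^ 2) (fun t => sphMoment w p (radInv α t)) := by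
  obtain ⟨hc, hlap, hi, hi₁⟩ := hw
  have hcast : ∀ s > (0 : ℝ), s ^ (N - 1) = s ^ ((N : ℝ) - 1) := fun s hs => by
    rw [← Real.rpow_natCast, Nat.cast_sub hN, Nat.cast_one]
  refine radial_transfer hα N
    (fun s hs => hasDerivAt_sphMoment (hc.of_le (by norm_num)) hp.continuous hs)
    (fun s hs => hasDerivAt_sphMoment₁ hc hp.continuous hs)
    (continuousOn_sphMoment₂ hc hp.continuous) (fun s hs => ?_) ?_ ?_
  · have h := sphMoment_ode hc hp (A := fun s => A (radVar α s)) hlap (fun _ _ => rfl) hs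
    rw [h, hl s hs, neg_neg]
  · exact (integrableOn_sphMoment_sq hc hp.continuous hi).congr_fun
      (fun s hs => by simp only [hcast s hs]) measurableSet_Ioi
  · exact (integrableOn_sphMoment₁_sq hc hp.continuous hi₁).congr_fun
      (fun s hs => by simp only [hcast s hs]) measurableSet_Ioi

theorem sphMoment_zero_right (w : EuclideanSpace ℝ (Fin N) → ℝ) (s : ℝ) :
    sphMoment w (fun _ => 0) s = 0 := by
  simp [sphMoment]

theorem eigenvalue_ne (hα : 0 < α) (hnoteven : ¬ ∃ i : ℕ, 0 < i ∧ α = 2 * i) {d : ℕ}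
    (hd : 0 < d) : kk N α ≠ d * (d + N - 2) * (2 / (2 + α)) ^ 2 := by
  have h2 : (2 + α) ≠ 0 := by positivity
  intro h
  rw [kk] at h
  field_simp at h
  have hd1 : (1 : ℝ) ≤ d := by exact_mod_cast hd
  have hpos : 0 < α + 2 * (N + d - 1) := by
    have : (0 : ℝ) ≤ N := Nat.cast_nonneg N
    linarith
  have hfac : (α - 2 * (d - 1)) * (α + 2 * (N + d - 1)) = 0 := by linear_combination h
  have hα' : α = 2 * (d - 1) := by
    rcases mul_eq_zero.1 hfac with h | h <;> linarith
  refine hnoteven ⟨d - 1, ?_, by rw [hα', Nat.cast_sub hd, Nat.cast_one]⟩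
  by_contra h0
  obtain rfl : d = 1 := by omega
  norm_num at hα'
  linarith

theorem LinSolution.sphMoment_ridge_eq_zero (hN : 3 ≤ N) (hα : 0 < α)
    (hnoteven : ¬ ∃ i : ℕ, 0 < i ∧ α = 2 * i) {M : ℝ} {φ : ℝ → ℝ}
    (hA : ContinuousOn A (Ioi 0)) (hM : ∀ t > (0 : ℝ), |A t| ≤ M)
    (hmorse : MorseIndexOne (kk N α) A) (hφ : SingularSol (kk N α) A (kk N α) φ)
    (hφ0 : ∃ t ∈ Ioi (0 : ℝ), φ t ≠ 0)
    (hw : LinSolution N α (fun x => A (radVar α ‖x‖)) w) (v : EuclideanSpace ℝ (Fin N)) (d : ℕ) :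
    ∀ s > (0 : ℝ), sphMoment w (ridge v d) s = 0 := by
  have hN3 : (3 : ℝ) ≤ N := by exact_mod_cast hN
  have hk : 1 < kk N α := by
    rw [kk, lt_div_iff₀ (by positivity)]
    linarith
  induction d using Nat.strong_induction_on with
  | _ d ih =>
    rcases Nat.eq_zero_or_pos d with rfl | hd
    · intro s _
      have : ridge v 0 = fun _ => 0 := by
        funext x
        have := sphereVol_univ_pos (N := N) (by omega)
        simp only [ridge, pow_zero, integral_const, smul_eq_mul, mul_one]
        rw [div_self this.ne', sub_self]
      rw [this, sphMoment_zero_right]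
    · have hd1 : (1 : ℝ) ≤ d := by exact_mod_cast hd
      have hl : ∀ s > (0 : ℝ), sphMoment w (angLap (ridge v d)) s =
          -(d * (d + N - 2) * sphMoment w (ridge v d) s) := by
        intro s hs
        have hw0 := continuous_polar hw.1.continuousOn hs
        have hi : ∀ n, Integrable (fun θ : Metric.sphere (0 : EuclideanSpace ℝ (Fin N)) 1 =>
            w (s • (θ : EuclideanSpace ℝ (Fin N))) * ridge v n θ) (sphereVol N) := fun n =>
          (hw0.mul ((contDiff_ridge v n).continuous.comp
            continuous_subtype_val)).integrable_of_compactSpace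
        have h0 : (d : ℝ) * (d - 1) * sphMoment w (ridge v (d - 2)) s = 0 := by
          rcases Nat.lt_or_ge d 2 with h | h
          · obtain rfl : d = 1 := by omega
            simp
          · rw [ih (d - 2) (by omega) s hs, mul_zero]
        calc sphMoment w (angLap (ridge v d)) s
            = ∫ θ, ((d * (d - 1) * ‖v‖ ^ 2) *
                (w (s • (θ : EuclideanSpace ℝ (Fin N))) * ridge v (d - 2) θ) -
              (d * (d + N - 2)) * (w (s • (θ : EuclideanSpace ℝ (Fin N))) * ridge v d θ))
                ∂sphereVol N := by
              refine integral_congr_ae (ae_of_all _ fun θ => ?_)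
              simp only [angLap_ridge (by omega : 0 < N) v d (norm_eq_of_mem_sphere θ)]
              ring
          _ = (d * (d - 1) * ‖v‖ ^ 2) * sphMoment w (ridge v (d - 2)) s -
              (d * (d + N - 2)) * sphMoment w (ridge v d) s := by
              rw [integral_sub ((hi _).const_mul _) ((hi _).const_mul _), integral_const_mul,
                integral_const_mul, sphMoment, sphMoment]
          _ = _ := by linear_combination ‖v‖ ^ 2 * h0
      have hsol := (hw.moment_transfer (by omega) hα (contDiff_ridge v d) hl).2
      have hμ : 0 < (d : ℝ) * (d + N - 2) * (2 / (2 + α)) ^ 2 := by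
        have : (0 : ℝ) < d + N - 2 := by linarith
        positivity
      intro s hs
      have := hmorse.eq_zero_of_singularSol hk hA hM (by linarith) hμ
        (eigenvalue_ne hα hnoteven hd) hφ hsol hφ0 (radVar α s) (radVar_pos hα hs)
      simpa only [radInv_radVar hα hs] using this

theorem LinSolution.eq_mean (hN : 3 ≤ N) (hα : 0 < α)
    (hnoteven : ¬ ∃ i : ℕ, 0 < i ∧ α = 2 * i) {M : ℝ} {φ : ℝ → ℝ}
    (hA : ContinuousOn A (Ioi 0)) (hM : ∀ t > (0 : ℝ), |A t| ≤ M)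
    (hmorse : MorseIndexOne (kk N α) A) (hφ : SingularSol (kk N α) A (kk N α) φ)
    (hφ0 : ∃ t ∈ Ioi (0 : ℝ), φ t ≠ 0)
    (hw : LinSolution N α (fun x => A (radVar α ‖x‖)) w) {x : EuclideanSpace ℝ (Fin N)}
    (hx : x ≠ 0) :
    w x = sphMoment w (fun _ => ((sphereVol N).real univ)⁻¹) ‖x‖ := by
  have hs : 0 < ‖x‖ := norm_pos_iff.2 hx
  have hm := sphereVol_univ_pos (N := N) (by omega)
  set m := (sphereVol N).real univ
  have hw0 := continuous_polar hw.1.continuousOn hs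
  have hmean : sphMoment w (fun _ => m⁻¹) ‖x‖ = (∫ θ : Metric.sphere
      (0 : EuclideanSpace ℝ (Fin N)) 1, w (‖x‖ • (θ : EuclideanSpace ℝ (Fin N)))
      ∂sphereVol N) * m⁻¹ := by
    rw [sphMoment, integral_mul_const]
  have hf : (fun θ : Metric.sphere (0 : EuclideanSpace ℝ (Fin N)) 1 =>
      w (‖x‖ • (θ : EuclideanSpace ℝ (Fin N))) - sphMoment w (fun _ => m⁻¹) ‖x‖) = 0 := by
    refine eq_zero_of_integral_mul_pow (hw0.sub continuous_const) fun v d => ?_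
    have h0 := hw.sphMoment_ridge_eq_zero hN hα hnoteven hA hM hmorse hφ hφ0 v d ‖x‖ hs
    have hq : Continuous fun θ : Metric.sphere (0 : EuclideanSpace ℝ (Fin N)) 1 =>
      ⟪v, (θ : EuclideanSpace ℝ (Fin N))⟫ ^ d := by fun_prop
    have hi : Integrable (fun θ : Metric.sphere (0 : EuclideanSpace ℝ (Fin N)) 1 =>
      w (‖x‖ • (θ : EuclideanSpace ℝ (Fin N))) * ⟪v, (θ : EuclideanSpace ℝ (Fin N))⟫ ^ d)
      (sphereVol N) := (hw0.mul hq).integrable_of_compactSpace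
    simp only [sphMoment, ridge, mul_sub] at h0
    rw [integral_sub hi (hw0.integrable_of_compactSpace.mul_const _), integral_mul_const] at h0
    simp only [sub_mul]
    rw [integral_sub hi (hq.integrable_of_compactSpace.const_mul _), integral_const_mul, hmean]
    rw [← h0]
    ring
  have hmem : ‖x‖⁻¹ • x ∈ Metric.sphere (0 : EuclideanSpace ℝ (Fin N)) 1 := by
    simp [norm_smul, hs.ne']
  have h := congrFun hf ⟨_, hmem⟩
  simp only [smul_smul, mul_inv_cancel₀ hs.ne', one_smul, Pi.zero_apply] at h
  linarith

theorem LinSolution.exists_linODESol (hN : 3 ≤ N) (hα : 0 < α)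
    (hnoteven : ¬ ∃ i : ℕ, 0 < i ∧ α = 2 * i) {M : ℝ} {φ : ℝ → ℝ}
    (hA : ContinuousOn A (Ioi 0)) (hM : ∀ t > (0 : ℝ), |A t| ≤ M)
    (hmorse : MorseIndexOne (kk N α) A) (hφ : SingularSol (kk N α) A (kk N α) φ)
    (hφ0 : ∃ t ∈ Ioi (0 : ℝ), φ t ≠ 0)
    (hw : LinSolution N α (fun x => A (radVar α ‖x‖)) w) :
    ∃ ψ, LinODESol (kk N α) A ψ ∧ ∀ x, x ≠ 0 → w x = ψ (radVar α ‖x‖) := by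
  obtain ⟨hC, hE, -, hode⟩ := hw.moment_transfer (by omega) hα
    (p := fun _ => ((sphereVol N).real univ)⁻¹) contDiff_const (l := 0) fun s _ => by
      rw [angLap_const]
      simp [sphMoment]
  refine ⟨_, ⟨hC, hE, fun t ht => ?_⟩, fun x hx => ?_⟩
  · have := hode t ht
    rw [zero_mul, zero_mul, zero_div] at this
    linarith
  · simp only [radInv_radVar hα (norm_pos_iff.2 hx)]
    exact hw.eq_mean hN hα hnoteven hA hM hmorse hφ hφ0 hx

end Radiality

section Profile

variable {k : ℝ} {F V : ℝ → ℝ}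

theorem exists_bound_of_deriv_tendsto {V : ℝ → ℝ} (hV : ContDiffOn ℝ 2 V (Ioi 0))
    (hV0 : Tendsto (deriv V) (𝓝[>] 0) (𝓝 0)) (hVinf : Tendsto V atTop (𝓝 0)) :
    ∃ K, ∀ t > (0 : ℝ), |V t| ≤ K := by
  have hd : ∀ t > (0 : ℝ), HasDerivAt V (deriv V t) t := fun t ht =>
    ((hV.differentiableOn two_ne_zero).differentiableAt (Ioi_mem_nhds ht)).hasDerivAt
  have h1 : ∀ᶠ t in 𝓝[>] (0 : ℝ), |deriv V t| < 1 := by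
    have := hV0.abs
    rw [abs_zero] at this
    exact this.eventually (Iio_mem_nhds one_pos)
  obtain ⟨δ, hδ, hδ1⟩ := mem_nhdsGT_iff_exists_Ioo_subset.1 h1
  have h2 : ∀ᶠ t in atTop, |V t| < 1 := by
    have := hVinf.abs
    rw [abs_zero] at this
    exact this.eventually (Iio_mem_nhds one_pos)
  obtain ⟨T, hT⟩ := eventually_atTop.1 h2
  have hδ' : (0 : ℝ) < δ := hδ
  obtain ⟨C, hC⟩ := (isCompact_Icc (a := δ / 2) (b := T)).exists_bound_of_continuousOn
    (hV.continuousOn.mono fun t ht => lt_of_lt_of_le (by positivity) ht.1)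
  refine ⟨max (max C 1) (|V (δ / 2)| + δ), fun t ht => ?_⟩
  rcases lt_or_ge t (δ / 2) with h | h
  · refine le_trans ?_ (le_max_right _ _)
    have := (convex_Ioo 0 δ).norm_image_sub_le_of_norm_hasDerivWithin_le (f := V) (f' := deriv V)
      (C := 1) (x := δ / 2) (y := t) (fun s hs => (hd s hs.1).hasDerivWithinAt)
      (fun s hs => (hδ1 hs).le) ⟨by positivity, by linarith⟩ ⟨ht, by linarith⟩
    rw [Real.norm_eq_abs, Real.norm_eq_abs, one_mul, abs_of_neg (by linarith : t - δ / 2 < 0)] at this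
    have h3 := abs_sub_abs_le_abs_sub (V t) (V (δ / 2))
    linarith
  · refine le_trans ?_ (le_max_left _ _)
    rcases lt_or_ge t T with h' | h'
    · exact (hC t ⟨h, h'.le⟩).trans (le_max_left _ _)
    · exact (hT t h').le.trans (le_max_right _ _)

theorem exists_bound_deriv_comp (hF : ContDiff ℝ 1 F) {K : ℝ}
    (hK : ∀ t > (0 : ℝ), |V t| ≤ K) : ∃ M, ∀ t > (0 : ℝ), |deriv F (V t)| ≤ M := by
  obtain ⟨M, hM⟩ := (isCompact_Icc (a := -K) (b := K)).exists_bound_of_continuousOn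
    (hF.continuous_deriv le_rfl).continuousOn
  exact ⟨M, fun t ht => hM _ (abs_le.1 (hK t ht))⟩

theorem singularSol_deriv (hF : ContDiff ℝ 1 F) (hV : ContDiffOn ℝ 2 V (Ioi 0))
    (hode : ∀ t > (0 : ℝ), -(deriv (deriv V) t) - k / t * deriv V t = F (V t))
    (hE : memE k (deriv V)) : SingularSol k (fun t => deriv F (V t)) k (deriv V) := by
  have hd : ∀ t > (0 : ℝ), HasDerivAt V (deriv V t) t := fun t ht =>
    ((hV.differentiableOn two_ne_zero).differentiableAt (Ioi_mem_nhds ht)).hasDerivAt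
  have key : ∀ t > (0 : ℝ), HasDerivAt (deriv (deriv V))
      (-(deriv F (V t) * deriv V t) -
        (-(k / t ^ 2) * deriv V t + k / t * deriv (deriv V) t)) t := by
    intro t ht
    have hFV : HasDerivAt (fun y => F (V y)) (deriv F (V t) * deriv V t) t :=
      HasDerivAt.comp (h₂ := F) t
        ((hF.differentiable one_ne_zero) (V t)).hasDerivAt (hd t ht)
    have hkt : HasDerivAt (fun y : ℝ => k / y) (-(k / t ^ 2)) t := by
      have := (hasDerivAt_inv ht.ne').const_mul k
      convert! this using 1
      ring
    refine (hFV.neg.sub (hkt.mul (hE.hasDerivAt ht))).congr_of_eventuallyEq ?_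
    filter_upwards [Ioi_mem_nhds ht] with y hy
    have := hode y hy
    simp only [Pi.sub_apply, Pi.neg_apply, Pi.mul_apply]
    linarith
  refine ⟨hE, fun t ht => (key t ht).differentiableAt.hasDerivAt, fun t ht => ?_⟩
  rw [(key t ht).deriv]
  field_simp
  ring

theorem exists_deriv_ne_zero (hV : ContDiffOn ℝ 2 V (Ioi 0)) (hVpos : ∀ t > (0 : ℝ), 0 < V t)
    (hVinf : Tendsto V atTop (𝓝 0)) : ∃ t ∈ Ioi (0 : ℝ), deriv V t ≠ 0 := by
  by_contra! h
  have hc : ∀ t > (0 : ℝ), V t = V 1 := fun t ht =>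
    isOpen_Ioi.is_const_of_deriv_eq_zero isPreconnected_Ioi (hV.differentiableOn two_ne_zero)
      h ht (mem_Ioi.2 one_pos)
  have hlim : Tendsto V atTop (𝓝 (V 1)) :=
    tendsto_const_nhds.congr' (by
      filter_upwards [eventually_gt_atTop 0] with t ht
      exact (hc t ht).symm)
  exact (hVpos 1 one_pos).ne' (tendsto_nhds_unique hlim hVinf)

end Profile

section RadialFunction

open scoped RealInnerProductSpace

theorem hasFDerivAt_norm_of_ne_zero {E : Type*} [NormedAddCommGroup E] [InnerProductSpace ℝ E]
    {x : E} (hx : x ≠ 0) : HasFDerivAt (fun y : E => ‖y‖) (‖x‖⁻¹ • innerSL ℝ x) x := by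
  have hn : 0 < ‖x‖ := norm_pos_iff.2 hx
  have h := (hasStrictFDerivAt_norm_sq x).hasFDerivAt.sqrt (by positivity)
  have he : (fun y : E => ‖y‖) = fun y => √(‖y‖ ^ 2) := by
    funext y
    rw [Real.sqrt_sq (norm_nonneg y)]
  rw [he]
  convert! h using 1
  ext y
  simp [Real.sqrt_sq hn.le]
  field_simp

variable {N : ℕ} {α : ℝ}

theorem hasFDerivAt_radial {Z : ℝ → ℝ} {z : ℝ} {x : EuclideanSpace ℝ (Fin N)} (hx : x ≠ 0)
    (hZ : HasDerivAt Z z ‖x‖) :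
    HasFDerivAt (fun y : EuclideanSpace ℝ (Fin N) => Z ‖y‖) ((z / ‖x‖) • innerSL ℝ x) x := by
  have h := hZ.comp_hasFDerivAt x (hasFDerivAt_norm_of_ne_zero hx)
  rw [smul_smul, ← div_eq_mul_inv] at h
  exact h

theorem lap_radial {Z Z₁ Z₂ : ℝ → ℝ} (h₁ : ∀ s > (0 : ℝ), HasDerivAt Z (Z₁ s) s)
    (h₂ : ∀ s > (0 : ℝ), HasDerivAt Z₁ (Z₂ s) s) {x : EuclideanSpace ℝ (Fin N)} (hx : x ≠ 0) :
    lap (fun y => Z ‖y‖) x = Z₂ ‖x‖ + (N - 1) * (Z₁ ‖x‖ / ‖x‖) := by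
  have hn : 0 < ‖x‖ := norm_pos_iff.2 hx
  have hG : HasDerivAt (fun s => Z₁ s / s) ((Z₂ ‖x‖ * ‖x‖ - Z₁ ‖x‖ * 1) / ‖x‖ ^ 2) ‖x‖ :=
    (h₂ _ hn).div (hasDerivAt_id _) hn.ne'
  have key : ∀ i : Fin N, fderiv ℝ (fun y => fderiv ℝ (fun y => Z ‖y‖) y
      (EuclideanSpace.single i 1)) x (EuclideanSpace.single i 1) =
      Z₁ ‖x‖ / ‖x‖ + (Z₂ ‖x‖ * ‖x‖ - Z₁ ‖x‖) / ‖x‖ ^ 3 * x i ^ 2 := by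
    intro i
    have hcoord : HasFDerivAt (fun y : EuclideanSpace ℝ (Fin N) => y i)
        (EuclideanSpace.proj (𝕜 := ℝ) i) x := (EuclideanSpace.proj (𝕜 := ℝ) i).hasFDerivAt
    have h := (hasFDerivAt_radial hx hG).mul hcoord
    have hev : (fun y => fderiv ℝ (fun y => Z ‖y‖) y (EuclideanSpace.single i (1 : ℝ)))
        =ᶠ[𝓝 x] fun y => Z₁ ‖y‖ / ‖y‖ * y i := by
      filter_upwards [isOpen_ne.mem_nhds hx] with y hy
      rw [(hasFDerivAt_radial hy (h₁ _ (norm_pos_iff.2 hy))).fderiv]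
      simp [EuclideanSpace.inner_single_right]
    have h' := h.fderiv
    change fderiv ℝ (fun y : EuclideanSpace ℝ (Fin N) => Z₁ ‖y‖ / ‖y‖ * y i) x = _ at h'
    rw [hev.fderiv_eq, h']
    simp [EuclideanSpace.inner_single_right]
    field_simp
  rw [lap, Finset.sum_congr rfl fun i _ => key i, Finset.sum_add_distrib, ← Finset.mul_sum,
    ← EuclideanSpace.real_norm_sq_eq]
  simp only [Finset.sum_const, Finset.card_univ, Fintype.card_fin, nsmul_eq_mul]
  field_simp
  ring

theorem LinODESol.linSolution (hN : 0 < N) (hα : 0 < α) {A ψ : ℝ → ℝ}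
    (hψ : LinODESol (kk N α) A ψ) :
    LinSolution N α (fun x => A (radVar α ‖x‖)) (fun x => ψ (radVar α ‖x‖)) := by
  obtain ⟨hC, hE, hode⟩ := hψ
  have hd₂ : ∀ t > (0 : ℝ), HasDerivAt (deriv ψ) (deriv (deriv ψ) t) t := fun t ht =>
    (((contDiffOn_succ_iff_deriv_of_isOpen (n := 1) isOpen_Ioi).1
      (by simpa [one_add_one_eq_two] using hC)).2.2.differentiableOn one_ne_zero
      |>.differentiableAt (Ioi_mem_nhds ht)).hasDerivAt
  have h₁ : ∀ s > (0 : ℝ), HasDerivAt (fun s => ψ (radVar α s))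
      (deriv ψ (radVar α s) * s ^ (α / 2)) s := fun s hs =>
    HasDerivAt.comp (h₂ := ψ) s (hE.hasDerivAt (radVar_pos hα hs)) (hasDerivAt_radVar hα hs)
  have h₂ : ∀ s > (0 : ℝ), HasDerivAt (fun s => deriv ψ (radVar α s) * s ^ (α / 2))
      (deriv (deriv ψ) (radVar α s) * s ^ (α / 2) * s ^ (α / 2) +
        deriv ψ (radVar α s) * (α / 2 * s ^ (α / 2 - 1))) s := fun s hs =>
    (HasDerivAt.comp (h₂ := deriv ψ) s (hd₂ _ (radVar_pos hα hs)) (hasDerivAt_radVar hα hs)).mul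
      (Real.hasDerivAt_rpow_const (Or.inl hs.ne'))
  have hc2 : (2 + α) ≠ 0 := by positivity
  have hbase : IntegrableOn (fun s : ℝ => s ^ ((N : ℝ) - 1) *
      (s ^ (α / 2) * deriv ψ (radVar α s)) ^ 2 +
      s ^ ((N : ℝ) - 1) * s ^ α * ψ (radVar α s) ^ 2) (Ioi 0) := by
    have h := ((integrableOn_comp_radVar hα _).1 hE.2).const_mul ((2 / (2 + α)) ^ kk N α)⁻¹
    refine IntegrableOn.congr_fun h (fun s hs => ?_) measurableSet_Ioi
    have hpos : (0 : ℝ) < (2 / (2 + α)) ^ kk N α := by positivity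
    simp only [radVar_rpow_mul hα N hs]
    rw [inv_mul_cancel_left₀ hpos.ne']
  have hcτ : ContinuousOn (radVar α) (Ioi 0) := fun s hs =>
    (hasDerivAt_radVar hα hs).continuousAt.continuousWithinAt
  have hτ : MapsTo (radVar α) (Ioi 0) (Ioi 0) := fun s hs => radVar_pos hα hs
  have hcast : ∀ s > (0 : ℝ), s ^ (N - 1) = s ^ ((N : ℝ) - 1) := fun s hs => by
    rw [← Real.rpow_natCast, Nat.cast_sub hN, Nat.cast_one]
  have : Nonempty (Fin N) := ⟨⟨0, hN⟩⟩
  have hnorm : ∀ f : ℝ → ℝ, ContinuousOn f (Ioi 0) →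
      (∀ s > (0 : ℝ), |s ^ ((N : ℝ) - 1) * f s| ≤ s ^ ((N : ℝ) - 1) *
        (s ^ (α / 2) * deriv ψ (radVar α s)) ^ 2 +
        s ^ ((N : ℝ) - 1) * s ^ α * ψ (radVar α s) ^ 2) →
      Integrable fun x : EuclideanSpace ℝ (Fin N) => f ‖x‖ := by
    intro f hf hle
    rw [integrable_fun_norm_addHaar (volume : Measure (EuclideanSpace ℝ (Fin N))) (f := f),
      finrank_euclideanSpace_fin]
    refine IntegrableOn.congr_fun (integrableOn_Ioi_of_abs_le
      ((continuousOn_rpow_Ioi ((N : ℝ) - 1)).mul hf) hbase hle) (fun s hs => ?_) measurableSet_Ioi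
    simp only [smul_eq_mul, Pi.mul_apply, hcast s hs]
  refine ⟨?_, fun x hx => ?_, ?_, ?_⟩
  · refine hC.comp (contDiffOn_const.mul fun x hx => ?_) fun x hx => radVar_pos hα
      (norm_pos_iff.2 hx)
    exact ((contDiffAt_norm ℝ hx).rpow_const_of_ne (norm_ne_zero_iff.2 hx)).contDiffWithinAt
  · have hs : 0 < ‖x‖ := norm_pos_iff.2 hx
    rw [lap_radial h₁ h₂ hx]
    beta_reduce
    have ho := hode _ (radVar_pos hα hs)
    have hv : radVar α ‖x‖ = 2 / (2 + α) * (‖x‖ ^ (α / 2) * ‖x‖) := by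
      rw [radVar, show (2 + α) / 2 = α / 2 + 1 by ring, Real.rpow_add hs, Real.rpow_one]
    have hpos := Real.rpow_pos_of_pos hs (α / 2)
    have hq := rpow_half_sq hs α
    rw [← hq, Real.rpow_sub hs, Real.rpow_one]
    generalize A (radVar α ‖x‖) = a at *
    generalize ψ (radVar α ‖x‖) = p₀ at *
    generalize deriv ψ (radVar α ‖x‖) = p₁ at *
    generalize deriv (deriv ψ) (radVar α ‖x‖) = p₂ at *
    rw [hv, kk] at ho
    generalize ‖x‖ ^ (α / 2) = q at *
    field_simp at ho ⊢
    linear_combination ho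
  · refine hnorm (fun s => s ^ α * ψ (radVar α s) ^ 2)
      ((continuousOn_rpow_Ioi α).mul ((hE.continuousOn.comp hcτ hτ).pow 2)) fun s hs => ?_
    rw [abs_of_nonneg (by positivity), ← mul_assoc]
    exact le_add_of_nonneg_left (by positivity)
  · have h := hnorm (fun s => (s ^ (α / 2) * deriv ψ (radVar α s)) ^ 2)
      (((continuousOn_rpow_Ioi _).mul (hE.continuousOn_deriv.comp hcτ hτ)).pow 2) fun s hs => by
        rw [abs_of_nonneg (by positivity)]
        exact le_add_of_nonneg_right (by positivity)
    refine h.congr ?_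
    filter_upwards [compl_mem_ae_iff.2 (measure_singleton (0 : EuclideanSpace ℝ (Fin N)))]
      with x hx
    have hx0 : x ≠ 0 := hx
    have hs : 0 < ‖x‖ := norm_pos_iff.2 hx0
    rw [(hasFDerivAt_radial hx0 (h₁ _ hs)).fderiv, norm_smul, innerSL_apply_norm, norm_div,
      norm_norm, div_mul_cancel₀ _ hs.ne', Real.norm_eq_abs, sq_abs, mul_comm]

end RadialFunction

theorem stmt5 (N : ℕ) (hN : 3 ≤ N) (α : ℝ) (hα : 0 < α)
    (F : ℝ → ℝ) (hF : ContDiff ℝ 1 F)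
    (V : ℝ → ℝ) (hV : ContDiffOn ℝ 2 V (Ioi 0)) (hVpos : ∀ t > (0:ℝ), 0 < V t)
    (hode : ∀ t > (0:ℝ), -(deriv (deriv V) t) - kk N α / t * deriv V t = F (V t))
    (hV'0 : Tendsto (deriv V) (𝓝[>] 0) (𝓝 0)) (hVinf : Tendsto V atTop (𝓝 0))
    (hmorse : MorseIndexOne (kk N α) (fun t => deriv F (V t)))
    (hV'E : memE (kk N α) (deriv V))
    (hdeg : ∃ ψ : ℝ → ℝ, LinODESol (kk N α) (fun t => deriv F (V t)) ψ ∧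
      ∃ t ∈ Ioi (0:ℝ), ψ t ≠ 0)
    (hnoteven : ¬ ∃ i : ℕ, 0 < i ∧ α = 2 * i) :
    (∀ w : EuclideanSpace ℝ (Fin N) → ℝ,
      LinSolution N α (fun x => deriv F (V (2 / (2 + α) * ‖x‖ ^ ((2 + α) / 2)))) w →
      ∃ ψ : ℝ → ℝ, LinODESol (kk N α) (fun t => deriv F (V t)) ψ ∧
        ∀ x : EuclideanSpace ℝ (Fin N), x ≠ 0 →
          w x = ψ (2 / (2 + α) * ‖x‖ ^ ((2 + α) / 2))) ∧
    ∀ n : ℕ,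
      (∃ ψs : Fin n → ℝ → ℝ,
        (∀ j, LinODESol (kk N α) (fun t => deriv F (V t)) (ψs j)) ∧
        (∀ c : Fin n → ℝ, (∀ t ∈ Ioi (0:ℝ), ∑ j, c j * ψs j t = 0) → c = 0) ∧
        ∀ ψ : ℝ → ℝ, LinODESol (kk N α) (fun t => deriv F (V t)) ψ →
          ∃ c : Fin n → ℝ, ∀ t ∈ Ioi (0:ℝ), ψ t = ∑ j, c j * ψs j t) →
      ∃ b : Fin n → EuclideanSpace ℝ (Fin N) → ℝ,
        (∀ j, LinSolution N α
          (fun x => deriv F (V (2 / (2 + α) * ‖x‖ ^ ((2 + α) / 2)))) (b j)) ∧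
        (∀ c : Fin n → ℝ,
          (∀ x : EuclideanSpace ℝ (Fin N), x ≠ 0 → ∑ j, c j * b j x = 0) → c = 0) ∧
        ∀ w : EuclideanSpace ℝ (Fin N) → ℝ,
          LinSolution N α (fun x => deriv F (V (2 / (2 + α) * ‖x‖ ^ ((2 + α) / 2)))) w →
          ∃ c : Fin n → ℝ, ∀ x : EuclideanSpace ℝ (Fin N), x ≠ 0 →
            w x = ∑ j, c j * b j x := by
  have hA : ContinuousOn (fun t => deriv F (V t)) (Ioi 0) :=
    (hF.continuous_deriv le_rfl).comp_continuousOn hV.continuousOn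
  obtain ⟨K, hK⟩ := exists_bound_of_deriv_tendsto hV hV'0 hVinf
  obtain ⟨M, hM⟩ := exists_bound_deriv_comp hF hK
  have hsol := singularSol_deriv hF hV hode hV'E
  have hne := exists_deriv_ne_zero hV hVpos hVinf
  have hrad : ∀ w : EuclideanSpace ℝ (Fin N) → ℝ,
      LinSolution N α (fun x => deriv F (V (2 / (2 + α) * ‖x‖ ^ ((2 + α) / 2)))) w →
      ∃ ψ : ℝ → ℝ, LinODESol (kk N α) (fun t => deriv F (V t)) ψ ∧
        ∀ x : EuclideanSpace ℝ (Fin N), x ≠ 0 →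
          w x = ψ (2 / (2 + α) * ‖x‖ ^ ((2 + α) / 2)) := fun w hw =>
    LinSolution.exists_linODESol (A := fun t => deriv F (V t)) hN hα hnoteven hA hM hmorse hsol
      hne hw
  refine ⟨hrad, fun n ⟨ψs, hψ, hind, hspan⟩ => ?_⟩
  refine ⟨fun j x => ψs j (radVar α ‖x‖), fun j => (hψ j).linSolution (by omega) hα,
    fun c hc => hind c fun t ht => ?_, fun w hw => ?_⟩
  · have hr := radInv_pos hα ht
    have hnorm : ‖EuclideanSpace.single (⟨0, by omega⟩ : Fin N) (radInv α t)‖ = radInv α t := by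
      rw [PiLp.norm_single, Real.norm_of_nonneg hr.le]
    have h := hc (EuclideanSpace.single (⟨0, by omega⟩ : Fin N) (radInv α t))
      (norm_pos_iff.1 (by rwa [hnorm]))
    simpa only [hnorm, radVar_radInv hα ht] using h
  · obtain ⟨ψ, hψ', hwψ⟩ := hrad w hw
    obtain ⟨c, hc⟩ := hspan ψ hψ'
    exact ⟨c, fun x hx => (hwψ x hx).trans (hc _ (radVar_pos hα (norm_pos_iff.2 hx)))⟩
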